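/- For a vector h = (h_0,...,h_d) of nonnegative integers, if h is the F-vector of some multicomplex M ⊆ S_d(X,(∞,a)) with |X_0| = (∑_{i=1}^m a_i) − d and |X_i| = n_i − a_i, then h is the h-vector of a (d−1)-dimensional shellable subcomplex of Λ_d(n,a). -/

import Mathlib

open Finset

variable {V : Type*} [Fintype V] [LinearOrder V]
variable {W : Type*} [Fintype W] [LinearOrder W]

def degM (μ : W →₀ ℕ) : ℕ := ∑ x, μ x

def degC (cx : W → ℕ) (i : ℕ) (μ : W →₀ ℕ) : ℕ :=
  ∑ x ∈ Finset.univ.filter (fun x => cx x = i), μ x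

/-- Membership in `S_d(X,(∞,a))` (variable colors in `{0,…,m}`; color `0` is `X₀`). -/
def InS (cx : W → ℕ) (a : ℕ → ℕ) (m d : ℕ) (μ : W →₀ ℕ) : Prop :=
  degM μ ≤ d ∧ ∀ i, 1 ≤ i → i ≤ m → degC cx i μ ≤ a i

def DivClosed (M : Finset (W →₀ ℕ)) : Prop :=
  ∀ μ ∈ M, ∀ ν : W →₀ ℕ, (∀ x, ν x ≤ μ x) → ν ∈ M

def FVec (M : Finset (W →₀ ℕ)) (j : ℕ) : ℕ := (M.filter (fun μ => degM μ = j)).card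

set_option linter.unusedSectionVars false

theorem shell_icc_sum (R B : Finset V) (hRB : R ⊆ B) :
    ∑ σ ∈ Finset.Icc R B, (Polynomial.X - 1 : Polynomial ℤ) ^ (B.card - σ.card)
      = Polynomial.X ^ (B.card - R.card) := by
  rw [Finset.Icc_eq_image_powerset hRB, Finset.sum_image]
  · have h := Finset.sum_pow_mul_eq_add_pow (1 : Polynomial ℤ) (Polynomial.X - 1) (B \ R)
    rw [Finset.card_sdiff_of_subset hRB] at h
    rw [show (1 + (Polynomial.X - 1) : Polynomial ℤ) = Polynomial.X by ring] at h
    rw [← h]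
    refine Finset.sum_congr rfl fun t ht => ?_
    rw [Finset.mem_powerset] at ht
    have hd : Disjoint R t := by
      rw [Finset.disjoint_left]; intro x hx hx'
      exact (Finset.mem_sdiff.1 (ht hx')).2 hx
    rw [Finset.card_union_of_disjoint hd]
    rw [one_pow, one_mul, Nat.sub_sub]
  · intro s hs t ht hst
    simp only [Finset.coe_powerset, Set.mem_preimage, Set.mem_powerset_iff, Finset.coe_subset] at hs ht
    ext x
    have h1 := Finset.ext_iff.1 hst x
    simp only [Finset.mem_union] at h1
    constructor
    · intro hx
      have := (Finset.mem_sdiff.1 (hs hx)).2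
      tauto
    · intro hx
      have := (Finset.mem_sdiff.1 (ht hx)).2
      tauto

theorem shell_abs {K : Type*} [LinearOrder K] (F : Finset (Finset V)) (d : ℕ)
    (hF : ∀ B ∈ F, B.card = d) (R : Finset V → Finset V) (hR : ∀ B ∈ F, R B ⊆ B)
    (key : Finset V → K)
    (h1 : ∀ B ∈ F, ∀ B' ∈ F, R B ⊆ B' → B ≠ B' → key B < key B')
    (h2 : ∀ B ∈ F, ∀ v ∈ R B, ∃ B' ∈ F, key B' < key B ∧ B.erase v ⊆ B')
    (h : ℕ → ℕ) (h3 : ∀ r, (F.filter (fun B => (R B).card = r)).card = h r) :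
    (∃ l : List (Finset V), l.Nodup ∧ (∀ τ, τ ∈ l ↔ τ ∈ F) ∧
        ∀ (k : ℕ) (hk : k < l.length), ∀ γ ⊆ l.get ⟨k, hk⟩,
          ((∀ v ∈ l.get ⟨k, hk⟩, (∃ τ' ∈ l.take k, (l.get ⟨k, hk⟩).erase v ⊆ τ') → v ∈ γ)
            ↔ ∀ τ' ∈ l.take k, ¬ γ ⊆ τ')) ∧
    (∑ i ∈ Finset.range (d + 1),
        (Polynomial.C ((((F.biUnion Finset.powerset).filter (fun σ => σ.card = i)).card : ℤ)))
          * (Polynomial.X - 1) ^ (d - i)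
        = ∑ i ∈ Finset.range (d + 1), (Polynomial.C ((h i : ℤ))) * Polynomial.X ^ (d - i)) := by
  classical
  constructor
  · let r : Finset V → Finset V → Prop := fun A B => key A ≤ key B
    have : Std.Total r := ⟨fun A B => le_total _ _⟩
    have : IsTrans (Finset V) r := ⟨fun A B C h h' => le_trans h h'⟩
    let l := F.toList.insertionSort r
    have hl : l.Pairwise r := List.pairwise_insertionSort r _
    have hp : l.Perm F.toList := List.perm_insertionSort r _
    have hnd : l.Nodup := hp.nodup_iff.2 F.nodup_toList
    have hmem : ∀ τ, τ ∈ l ↔ τ ∈ F := fun τ => by rw [hp.mem_iff, Finset.mem_toList]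
    refine ⟨l, hnd, hmem, ?_⟩
    intro k hk γ hγ
    have hB : l.get ⟨k, hk⟩ ∈ F := (hmem _).1 (List.get_mem _ _)
    have hbef : ∀ τ' ∈ l.take k, τ' ∈ F ∧ key τ' ≤ key (l.get ⟨k, hk⟩) ∧ τ' ≠ l.get ⟨k, hk⟩ := by
      intro τ' hτ
      obtain ⟨j, hj, rfl⟩ := List.mem_take_iff_getElem.1 hτ
      have hjk : j < k := by omega
      refine ⟨(hmem _).1 (List.getElem_mem _), ?_, ?_⟩
      · exact List.pairwise_iff_getElem.1 hl j k _ hk hjk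
      · intro he
        have := (hnd.getElem_inj_iff (hi := by omega) (hj := hk)).1 he
        omega
    have hbef' : ∀ τ' ∈ F, key τ' < key (l.get ⟨k, hk⟩) → τ' ∈ l.take k := by
      intro τ' hτ hlt
      obtain ⟨j, hj, rfl⟩ := List.getElem_of_mem ((hmem _).2 hτ)
      rw [List.mem_take_iff_getElem]
      refine ⟨j, ?_, rfl⟩
      by_contra hcon
      have hkj : k ≤ j := by omega
      rcases hkj.eq_or_lt with e | e
      · subst e; exact lt_irrefl _ hlt
      · exact absurd (List.pairwise_iff_getElem.1 hl k j hk hj e) (not_le.2 hlt)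
    constructor
    · intro hall τ' hτ hsub
      obtain ⟨a1, a2, a3⟩ := hbef τ' hτ
      have hRs : R (l.get ⟨k, hk⟩) ⊆ τ' := by
        intro v hv
        obtain ⟨B', hB', hlt, hsub'⟩ := h2 _ hB v hv
        exact hsub (hall v (hR _ hB hv) ⟨B', hbef' _ hB' hlt, hsub'⟩)
      exact absurd (h1 _ hB _ a1 hRs a3.symm) (not_lt.2 a2)
    · intro hall v hv ⟨τ', hτ, hsub⟩
      by_contra hvγ
      apply hall τ' hτ
      intro x hx
      refine hsub (Finset.mem_erase.2 ⟨?_, hγ hx⟩)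
      rintro rfl; exact hvγ hx
  · have hΔ : F.biUnion Finset.powerset = F.biUnion (fun B => Finset.Icc (R B) B) := by
      ext σ
      simp only [Finset.mem_biUnion, Finset.mem_powerset, Finset.mem_Icc]
      constructor
      · rintro ⟨B0, hB0, hs0⟩
        obtain ⟨B, hB, hmin⟩ := Finset.exists_min_image (F.filter (fun B => σ ⊆ B)) key
          ⟨B0, Finset.mem_filter.2 ⟨hB0, hs0⟩⟩
        rw [Finset.mem_filter] at hB
        refine ⟨B, hB.1, ?_, hB.2⟩
        intro v hv
        by_contra hvs
        obtain ⟨B', hB', hlt, hsub⟩ := h2 B hB.1 v hv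
        refine absurd (hmin B' (Finset.mem_filter.2 ⟨hB', ?_⟩)) (not_le.2 hlt)
        intro x hx
        refine hsub (Finset.mem_erase.2 ⟨?_, hB.2 hx⟩)
        rintro rfl; exact hvs hx
      · rintro ⟨B, hB, _, hs⟩
        exact ⟨B, hB, hs⟩
    have hcard : ∀ σ ∈ F.biUnion Finset.powerset, σ.card ∈ Finset.range (d + 1) := by
      intro σ hσ
      simp only [Finset.mem_biUnion, Finset.mem_powerset] at hσ
      obtain ⟨B, hB, hs⟩ := hσ
      have := Finset.card_le_card hs
      rw [hF B hB] at this
      simp; omega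
    have e1 : ∑ i ∈ Finset.range (d + 1),
        (Polynomial.C ((((F.biUnion Finset.powerset).filter (fun σ => σ.card = i)).card : ℤ)))
          * (Polynomial.X - 1) ^ (d - i)
        = ∑ σ ∈ F.biUnion Finset.powerset, (Polynomial.X - 1 : Polynomial ℤ) ^ (d - σ.card) := by
      rw [← Finset.sum_fiberwise_of_maps_to hcard]
      refine Finset.sum_congr rfl fun i _ => ?_
      rw [Finset.sum_congr rfl (g := fun _ => (Polynomial.X - 1 : Polynomial ℤ) ^ (d - i))]
      · rw [Finset.sum_const, nsmul_eq_mul]; simp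
      · intro σ hσ
        rw [(Finset.mem_filter.1 hσ).2]
    have e2 : ∑ i ∈ Finset.range (d + 1), (Polynomial.C ((h i : ℤ))) * Polynomial.X ^ (d - i)
        = ∑ B ∈ F, (Polynomial.X : Polynomial ℤ) ^ (d - (R B).card) := by
      rw [← Finset.sum_fiberwise_of_maps_to (s := F) (t := Finset.range (d+1))
        (g := fun B => (R B).card)]
      · refine Finset.sum_congr rfl fun i _ => ?_
        rw [Finset.sum_congr rfl (g := fun _ => (Polynomial.X : Polynomial ℤ) ^ (d - i))]
        · rw [Finset.sum_const, nsmul_eq_mul, h3]; simp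
        · intro σ hσ
          rw [(Finset.mem_filter.1 hσ).2]
      · intro B hB
        have := Finset.card_le_card (hR B hB)
        rw [hF B hB] at this
        simp; omega
    rw [e1, e2, hΔ, Finset.sum_biUnion]
    · refine Finset.sum_congr rfl fun B hB => ?_
      rw [← hF B hB]
      exact shell_icc_sum _ _ (hR B hB)
    · intro B hB B' hB' hne
      rw [Function.onFun, Finset.disjoint_left]
      intro σ hσ hσ'
      rw [Finset.mem_Icc] at hσ hσ'
      have := h1 B hB B' hB' (hσ.1.trans hσ'.2) hne
      have := h1 B' hB' B hB (hσ'.1.trans hσ.2) hne.symm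
      exact lt_asymm ‹_› this


noncomputable def cset (x y : W) (μ : W →₀ ℕ) (p q : ℕ) : W →₀ ℕ := (μ.update x p).update y q

theorem cset_x {x y : W} (hxy : x ≠ y) (μ : W →₀ ℕ) (p q : ℕ) : cset x y μ p q x = p := by
  simp [cset, hxy]

theorem cset_y {x y : W} (μ : W →₀ ℕ) (p q : ℕ) : cset x y μ p q y = q := by
  simp [cset]

theorem cset_z {x y z : W} (hx : z ≠ x) (hy : z ≠ y) (μ : W →₀ ℕ) (p q : ℕ) :
    cset x y μ p q z = μ z := by
  simp [cset, hx, hy]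

theorem cset_congr {x y : W} (μ ν : W →₀ ℕ) (hz : ∀ z, z ≠ x → z ≠ y → μ z = ν z) (p q : ℕ) :
    cset x y μ p q = cset x y ν p q := by
  by_cases hxy : x = y
  · subst hxy
    ext z
    by_cases h1 : z = x
    · subst h1; simp [cset_y]
    · rw [cset_z h1 h1, cset_z h1 h1, hz z h1 h1]
  ext z
  by_cases h1 : z = x
  · subst h1; simp [cset_x hxy]
  by_cases h2 : z = y
  · subst h2; simp [cset_y]
  rw [cset_z h1 h2, cset_z h1 h2, hz z h1 h2]

/-- the fibre predicate -/
def cfib (M : Finset (W →₀ ℕ)) (x y : W) (μ : W →₀ ℕ) (p : ℕ) : Prop :=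
  p ≤ μ x + μ y ∧ cset x y μ p (μ x + μ y - p) ∈ M

noncomputable instance cfibDec (M : Finset (W →₀ ℕ)) (x y : W) (μ : W →₀ ℕ) :
    DecidablePred (cfib M x y μ) := Classical.decPred _

noncomputable def cfin (M : Finset (W →₀ ℕ)) (x y : W) (μ : W →₀ ℕ) : Finset ℕ :=
  (Finset.range (μ x + μ y + 1)).filter (cfib M x y μ)

theorem mem_cfin (M : Finset (W →₀ ℕ)) (x y : W) (μ : W →₀ ℕ) (p : ℕ) :
    p ∈ cfin M x y μ ↔ cfib M x y μ p := by
  simp only [cfin, Finset.mem_filter, Finset.mem_range, cfib]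
  constructor
  · exact fun h => h.2
  · exact fun h => ⟨by omega, h⟩

noncomputable def cmap (M : Finset (W →₀ ℕ)) (x y : W) (μ : W →₀ ℕ) : W →₀ ℕ :=
  cset x y μ (Nat.count (cfib M x y μ) (μ x)) (μ x + μ y - Nat.count (cfib M x y μ) (μ x))

theorem cfib_congr {M : Finset (W →₀ ℕ)} {x y : W} {μ ν : W →₀ ℕ}
    (hz : ∀ z, z ≠ x → z ≠ y → μ z = ν z) (hr : μ x + μ y = ν x + ν y) :
    cfib M x y μ = cfib M x y ν := by
  funext p
  simp only [cfib, hr, cset_congr μ ν hz]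

theorem cset_self {x y : W} (hxy : x ≠ y) (μ : W →₀ ℕ) : cset x y μ (μ x) (μ y) = μ := by
  ext z
  by_cases h1 : z = x
  · subst h1; simp [cset_x hxy]
  by_cases h2 : z = y
  · subst h2; simp [cset_y]
  rw [cset_z h1 h2]

theorem cfib_self {M : Finset (W →₀ ℕ)} {x y : W} (hxy : x ≠ y) {μ : W →₀ ℕ} (hμ : μ ∈ M) :
    cfib M x y μ (μ x) := by
  refine ⟨by omega, ?_⟩
  rw [Nat.add_sub_cancel_left, cset_self hxy]; exact hμ

theorem ccount_le (M : Finset (W →₀ ℕ)) (x y : W) (μ : W →₀ ℕ) :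
    Nat.count (cfib M x y μ) (μ x) ≤ μ x := Nat.count_le _

theorem cmap_z {M : Finset (W →₀ ℕ)} {x y z : W} (hx : z ≠ x) (hy : z ≠ y) (μ : W →₀ ℕ) :
    cmap M x y μ z = μ z := cset_z hx hy _ _ _

theorem cmap_r {M : Finset (W →₀ ℕ)} {x y : W} (hxy : x ≠ y) (μ : W →₀ ℕ) :
    cmap M x y μ x + cmap M x y μ y = μ x + μ y := by
  have := ccount_le M x y μ
  simp only [cmap, cset_x hxy, cset_y]; omega

theorem cmap_fib {M : Finset (W →₀ ℕ)} {x y : W} (hxy : x ≠ y) (μ : W →₀ ℕ) :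
    cfib M x y (cmap M x y μ) = cfib M x y μ :=
  cfib_congr (fun _ h1 h2 => cmap_z h1 h2 μ) (cmap_r hxy μ)

theorem cmap_inj {M : Finset (W →₀ ℕ)} {x y : W} (hxy : x ≠ y) {μ ν : W →₀ ℕ} (hμ : μ ∈ M)
    (hν : ν ∈ M) (h : cmap M x y μ = cmap M x y ν) : μ = ν := by
  have hf : cfib M x y μ = cfib M x y ν := by
    rw [← cmap_fib hxy μ, h, cmap_fib hxy]
  have hc : Nat.count (cfib M x y μ) (μ x) = Nat.count (cfib M x y μ) (ν x) := by
    have := DFunLike.congr_fun h x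
    simp only [cmap, cset_x hxy] at this
    simpa [hf] using this
  have hx : μ x = ν x :=
    Nat.count_injective (cfib_self hxy hμ) (hf ▸ cfib_self hxy hν) hc
  have hr : μ x + μ y = ν x + ν y := by
    rw [← cmap_r (M := M) hxy μ, h, cmap_r hxy]
  ext z
  by_cases h1 : z = x
  · subst h1; exact hx
  by_cases h2 : z = y
  · subst h2; omega
  rw [← cmap_z (M := M) h1 h2 μ, h, cmap_z h1 h2]

theorem mem_cimage {M : Finset (W →₀ ℕ)} {x y : W} (hxy : x ≠ y) (ν : W →₀ ℕ) :
    ν ∈ M.image (cmap M x y) ↔ ν x < (cfin M x y ν).card := by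
  rw [Finset.mem_image]
  constructor
  · rintro ⟨μ, hμ, rfl⟩
    have e : cfin M x y (cmap M x y μ) = cfin M x y μ := by
      ext p; rw [mem_cfin, mem_cfin, cmap_fib hxy]
    rw [e]
    simp only [cmap, cset_x hxy]
    rw [Nat.count_eq_card_filter_range]
    apply Finset.card_lt_card
    rw [Finset.ssubset_iff_of_subset]
    · exact ⟨μ x, (mem_cfin _ _ _ _ _).2 (cfib_self hxy hμ), by simp⟩
    · intro p hp
      exact (mem_cfin _ _ _ _ _).2 (Finset.mem_filter.1 hp).2
  · intro hlt
    have hlt' : ∀ hf : (Set.ofPred (cfib M x y ν)).Finite, ν x < hf.toFinset.card := by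
      intro hf
      convert hlt
      ext p
      rw [mem_cfin, Set.Finite.mem_toFinset]; rfl
    have hp := Nat.nth_mem _ hlt'
    have hcnt := Nat.count_nth hlt'
    set p := Nat.nth (cfib M x y ν) (ν x) with hpdef
    refine ⟨_, hp.2, ?_⟩
    have h1 : p ≤ ν x + ν y := hp.1
    have hf : cfib M x y (cset x y ν p (ν x + ν y - p)) = cfib M x y ν := by
      apply cfib_congr
      · intro z h1 h2; rw [cset_z h1 h2]
      · rw [cset_x hxy, cset_y]; omega
    have hcx : Nat.count (cfib M x y (cset x y ν p (ν x + ν y - p)))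
        (cset x y ν p (ν x + ν y - p) x) = ν x := by
      rw [cset_x hxy]
      refine Eq.trans ?_ hcnt
      congr!
    ext z
    by_cases h1 : z = x
    · subst h1
      rw [cmap, cset_x hxy, hcx]
    by_cases h2 : z = y
    · subst h2
      rw [cmap, cset_y, hcx, cset_x hxy, cset_y]; omega
    rw [cmap_z h1 h2, cset_z h1 h2]

theorem divClosed_of_single {M : Finset (W →₀ ℕ)}
    (h : ∀ μ ∈ M, ∀ z, 0 < μ z → μ.update z (μ z - 1) ∈ M) : DivClosed M := by
  have key : ∀ k, ∀ μ ∈ M, ∀ ν : W →₀ ℕ, (∀ x, ν x ≤ μ x) → ∑ x, (μ x - ν x) = k → ν ∈ M := by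
    intro k
    induction k with
    | zero =>
      intro μ hμ ν hν hk
      have : ν = μ := by
        ext z
        have h0 := Finset.sum_eq_zero_iff.1 hk z (Finset.mem_univ _)
        have := hν z
        omega
      rwa [this]
    | succ k ih =>
      intro μ hμ ν hν hk
      have : ∃ z, ν z < μ z := by
        by_contra hcon
        push Not at hcon
        rw [Finset.sum_eq_zero] at hk
        · omega
        · intro z _; have := hcon z; omega
      obtain ⟨z, hz⟩ := this
      refine ih _ (h μ hμ z (by omega)) ν ?_ ?_
      · intro w
        by_cases hw : w = z
        · subst hw; simp; omega
        · simp [hw, hν w]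
      · rw [← Finset.add_sum_erase _ _ (Finset.mem_univ z)] at hk ⊢
        have e : ∑ w ∈ Finset.univ.erase z, ((μ.update z (μ z - 1)) w - ν w)
            = ∑ w ∈ Finset.univ.erase z, (μ w - ν w) := by
          refine Finset.sum_congr rfl fun w hw => ?_
          simp [Finset.ne_of_mem_erase hw]
        rw [e]; simp; omega
  intro μ hμ ν hν
  exact key _ μ hμ ν hν rfl

theorem cimage_div {M : Finset (W →₀ ℕ)} {x y : W} (hxy : x ≠ y) (hM : DivClosed M) :
    DivClosed (M.image (cmap M x y)) := by
  apply divClosed_of_single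
  intro μ hμ z hz
  rw [mem_cimage hxy] at hμ ⊢
  by_cases h1 : z = x
  · subst h1
    have hsub : ((cfin M z y μ).erase 0).image (fun p => p - 1) ⊆
        cfin M z y (μ.update z (μ z - 1)) := by
      intro q hq
      obtain ⟨p, hp, rfl⟩ := Finset.mem_image.1 hq
      rw [Finset.mem_erase, mem_cfin] at hp
      rw [mem_cfin]
      obtain ⟨h0, h1, h2⟩ := hp
      refine ⟨by simp [hxy.symm]; omega, ?_⟩
      refine hM _ h2 _ ?_
      intro w
      by_cases hw : w = z
      · subst hw; rw [cset_x hxy, cset_x hxy]; omega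
      by_cases hw2 : w = y
      · subst hw2; rw [cset_y, cset_y]; simp [hxy.symm]; omega
      rw [cset_z hw hw2, cset_z hw hw2]; simp [hw]
    have hc := Finset.card_le_card hsub
    rw [Finset.card_image_of_injOn] at hc
    · have := Finset.pred_card_le_card_erase (s := cfin M z y μ) (a := 0)
      simp; omega
    · intro p hp q hq hpq
      simp at hp hq hpq
      omega
  by_cases h2 : z = y
  · subst h2
    have hxν : (μ.update z (μ z - 1)) x = μ x := by simp [hxy]
    rw [hxν]
    have hyν : (μ.update z (μ z - 1)) z = μ z - 1 := by simp
    have hstep : ∀ p q, cfib M x z μ p → q ≤ p → p ≤ q + 1 → q ≤ μ x + μ z - 1 →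
        cfib M x z (μ.update z (μ z - 1)) q := by
      intro p q hp h1 h2 h3
      refine ⟨by rw [hxν, hyν]; omega, ?_⟩
      refine hM _ hp.2 _ ?_
      have := hp.1
      intro w
      by_cases hw : w = x
      · subst hw; rw [cset_x hxy, cset_x hxy]; omega
      by_cases hw2 : w = z
      · subst hw2; rw [cset_y, cset_y, hxν, hyν]; omega
      rw [cset_z hw hw2, cset_z hw hw2]; simp [hw2]
    by_cases hfull : ∀ p ≤ μ x + μ z, cfib M x z μ p
    · have hsub : Finset.range (μ x + μ z) ⊆ cfin M x z (μ.update z (μ z - 1)) := by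
        intro q hq
        rw [Finset.mem_range] at hq
        rw [mem_cfin]
        exact hstep q q (hfull q (by omega)) le_rfl (by omega) (by omega)
      have := Finset.card_le_card hsub
      rw [Finset.card_range] at this
      omega
    · push Not at hfull
      obtain ⟨q0, hq0, hnq⟩ := hfull
      refine lt_of_lt_of_le hμ ?_
      apply Finset.card_le_card_of_injOn (fun p => if p < q0 then p else p - 1)
      · intro p hp
        rw [Finset.mem_coe, mem_cfin] at hp
        have hne : p ≠ q0 := by rintro rfl; exact hnq hp
        have := hp.1
        simp only [Finset.mem_coe]
        rw [mem_cfin]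
        split_ifs with hlt
        · exact hstep p p hp le_rfl (by omega) (by omega)
        · exact hstep p (p - 1) hp (by omega) (by omega) (by omega)
      · intro p hp q hq hpq
        rw [Finset.mem_coe, mem_cfin] at hp hq
        have hne : p ≠ q0 := by rintro rfl; exact hnq hp
        have hne' : q ≠ q0 := by rintro rfl; exact hnq hq
        simp only at hpq
        split_ifs at hpq <;> omega
  · have e1 : (μ.update z (μ z - 1)) x = μ x := by simp [Ne.symm h1]
    have e2 : (μ.update z (μ z - 1)) y = μ y := by simp [Ne.symm h2]
    rw [e1]
    refine lt_of_lt_of_le hμ (Finset.card_le_card ?_)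
    intro p hp
    rw [mem_cfin] at hp ⊢
    refine ⟨by rw [e1, e2]; exact hp.1, ?_⟩
    rw [e1, e2]
    refine hM _ hp.2 _ ?_
    intro w
    by_cases hw : w = x
    · subst hw; rw [cset_x hxy, cset_x hxy]
    by_cases hw2 : w = y
    · subst hw2; rw [cset_y, cset_y]
    rw [cset_z hw hw2, cset_z hw hw2]
    by_cases hw3 : w = z
    · subst hw3; simp
    · simp [hw3]

theorem sum_split2 {x y : W} (hxy : x ≠ y) (f : W → ℕ) :
    ∑ z, f z = f x + (f y + ∑ z ∈ (Finset.univ.erase x).erase y, f z) := by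
  rw [← Finset.add_sum_erase _ _ (Finset.mem_univ x)]
  rw [← Finset.add_sum_erase _ f (Finset.mem_erase.2 ⟨hxy.symm, Finset.mem_univ y⟩)]

/-- weighted sums after the compression map -/
theorem cmap_sum {M : Finset (W →₀ ℕ)} {x y : W} (hxy : x ≠ y) (μ : W →₀ ℕ) (g : W → ℕ) :
    ∑ z, g z * cmap M x y μ z + g x * (μ x - cmap M x y μ x)
      = ∑ z, g z * μ z + g y * (μ x - cmap M x y μ x) := by
  rw [sum_split2 hxy, sum_split2 hxy (fun z => g z * μ z)]
  have e : ∑ z ∈ (Finset.univ.erase x).erase y, g z * cmap M x y μ z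
      = ∑ z ∈ (Finset.univ.erase x).erase y, g z * μ z := by
    refine Finset.sum_congr rfl fun z hz => ?_
    simp only [Finset.mem_erase] at hz
    rw [cmap_z hz.2.1 hz.1]
  rw [e]
  have h1 := cmap_r (M := M) hxy μ
  have h2 : cmap M x y μ x ≤ μ x := by
    simp only [cmap, cset_x hxy]; exact ccount_le M x y μ
  obtain ⟨k, hk⟩ := Nat.exists_eq_add_of_le h2
  have h3 : cmap M x y μ y = μ y + k := by omega
  rw [h3, hk, Nat.add_sub_cancel_left]
  ring

theorem degM_cmap {M : Finset (W →₀ ℕ)} {x y : W} (hxy : x ≠ y) (μ : W →₀ ℕ) :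
    degM (cmap M x y μ) = degM μ := by
  have := cmap_sum (M := M) hxy μ (fun _ => 1)
  simp only [one_mul] at this
  unfold degM; omega

theorem degC_eq (cx : W → ℕ) (i : ℕ) (μ : W →₀ ℕ) :
    degC cx i μ = ∑ z, (if cx z = i then 1 else 0) * μ z := by
  unfold degC
  rw [Finset.sum_filter]
  refine Finset.sum_congr rfl fun z _ => ?_
  split_ifs <;> simp

theorem compress (cx : W → ℕ) (a : ℕ → ℕ) (m d : ℕ) (rk : W → ℕ)
    (M : Finset (W →₀ ℕ)) (hMS : ∀ μ ∈ M, InS cx a m d μ) (hMdc : DivClosed M) :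
    ∃ M' : Finset (W →₀ ℕ), (∀ μ ∈ M', InS cx a m d μ) ∧ DivClosed M' ∧
      (∀ j, FVec M' j = FVec M j) ∧
      ∀ μ ∈ M', ∀ x y, 0 < μ x → rk y < rk x → (cx y = cx x ∨ cx y = 0) →
        cset x y μ (μ x - 1) (μ y + 1) ∈ M' := by
  let wt : (W →₀ ℕ) → ℕ := fun μ => ∑ z, rk z * μ z
  let P : ℕ → Prop := fun k => ∃ M' : Finset (W →₀ ℕ), (∀ μ ∈ M', InS cx a m d μ) ∧ DivClosed M' ∧
      (∀ j, FVec M' j = FVec M j) ∧ ∑ μ ∈ M', wt μ = k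
  have hP : ∃ k, P k := ⟨_, M, hMS, hMdc, fun _ => rfl, rfl⟩
  classical
  obtain ⟨M', h1, h2, h3, h4⟩ := Nat.find_spec hP
  refine ⟨M', h1, h2, h3, ?_⟩
  intro μ hμ x y hx hrk hcol
  by_contra hnot
  have hxy : x ≠ y := by rintro rfl; omega
  have hinj : Set.InjOn (cmap M' x y) (M' : Set (W →₀ ℕ)) := fun _ h _ h' e => cmap_inj hxy h h' e
  have hle : ∀ ν, cmap M' x y ν x ≤ ν x := by
    intro ν
    simp only [cmap, cset_x hxy]; exact ccount_le M' x y ν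
  have hwt : ∀ ν, wt (cmap M' x y ν) + (rk x - rk y) * (ν x - cmap M' x y ν x) = wt ν := by
    intro ν
    have := cmap_sum (M := M') hxy ν rk
    obtain ⟨k, hk⟩ := Nat.exists_eq_add_of_lt hrk
    simp only [wt]
    have e : rk x - rk y = k + 1 := by omega
    rw [e]
    rw [hk] at this
    nlinarith
  have hlt : cmap M' x y μ x < μ x := by
    simp only [cmap, cset_x hxy]
    rw [Nat.count_eq_card_filter_range]
    have : (Finset.filter (cfib M' x y μ) (Finset.range (μ x))) ⊂ Finset.range (μ x) := by
      rw [Finset.ssubset_iff_of_subset (Finset.filter_subset _ _)]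
      refine ⟨μ x - 1, by simp; omega, ?_⟩
      intro hmem
      apply hnot
      have := (Finset.mem_filter.1 hmem).2.2
      rwa [show μ x + μ y - (μ x - 1) = μ y + 1 by omega] at this
    simpa using Finset.card_lt_card this
  have hsum : ∑ ν ∈ M'.image (cmap M' x y), wt ν < ∑ ν ∈ M', wt ν := by
    rw [Finset.sum_image hinj]
    apply Finset.sum_lt_sum
    · intro ν _; have := hwt ν; omega
    · refine ⟨μ, hμ, ?_⟩
      have := hwt μ
      have : 0 < (rk x - rk y) * (μ x - cmap M' x y μ x) := Nat.mul_pos (by omega) (by omega)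
      omega
  rw [h4] at hsum
  refine Nat.find_min hP hsum ⟨_, ?_, cimage_div hxy h2, ?_, rfl⟩
  · intro ν hν
    obtain ⟨μ', hμ', rfl⟩ := Finset.mem_image.1 hν
    obtain ⟨b1, b2⟩ := h1 μ' hμ'
    refine ⟨by rw [degM_cmap hxy]; exact b1, ?_⟩
    intro i hi him
    refine le_trans ?_ (b2 i hi him)
    rw [degC_eq, degC_eq]
    have := cmap_sum (M := M') hxy μ' (fun z => if cx z = i then 1 else 0)
    by_cases hxi : cx x = i
    · by_cases hyi : cx y = i
      · simp only [hxi, hyi, if_true] at this; omega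
      · simp only [hxi, hyi, if_true, if_false] at this; omega
    · have hyi : cx y ≠ i := by
        rcases hcol with h | h <;> omega
      simp only [hxi, hyi, if_false] at this; omega
  · intro j
    rw [← h3 j]
    unfold FVec
    rw [Finset.filter_image, Finset.card_image_of_injOn]
    · simp only [degM_cmap hxy]
    · exact hinj.mono (by intro z hz; exact (Finset.mem_filter.1 hz).1)


def bc (c : V → ℕ) (B : Finset V) (i : ℕ) : ℕ := (B.filter (fun v => c v = i)).card

def gp (c : V → ℕ) (a : ℕ → ℕ) (B : Finset V) (i : ℕ) : ℕ := a i - bc c B i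

def Gs (c : V → ℕ) (a : ℕ → ℕ) (m : ℕ) (B : Finset V) (i : ℕ) : ℕ :=
  ∑ j ∈ Finset.Ioc i m, gp c a B j

def tset (c : V → ℕ) (B : Finset V) (v : V) : Finset V :=
  Finset.univ.filter (fun w => c w = c v ∧ w < v ∧ w ∉ B)

def tt (c : V → ℕ) (B : Finset V) (v : V) : ℕ := (tset c B v).card

/-- the variable attached to a vertex of a facet (`(0,0)` stands for the unit) -/
def vr (c : V → ℕ) (a : ℕ → ℕ) (m : ℕ) (B : Finset V) (v : V) : ℕ × ℕ :=
  if gp c a B (c v) < tt c B v then (c v, tt c B v - gp c a B (c v))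
  else (0, tt c B v + Gs c a m B (c v))

def Phi (c : V → ℕ) (a : ℕ → ℕ) (m : ℕ) (B : Finset V) : Multiset (ℕ × ℕ) :=
  (B.val.map (vr c a m B)).filter (fun z => z ≠ (0, 0))

def Fac (c : V → ℕ) (a : ℕ → ℕ) (m : ℕ) (U : Finset V) (d : ℕ) (B : Finset V) : Prop :=
  B ⊆ U ∧ B.card = d ∧ ∀ i ∈ Finset.Icc 1 m, bc c B i ≤ a i

def Smon (c : V → ℕ) (a : ℕ → ℕ) (m : ℕ) (U : Finset V) (d N : ℕ) (μ : Multiset (ℕ × ℕ)) : Prop :=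
  Multiset.card μ ≤ d ∧ (∀ i ∈ Finset.Icc 1 m, μ.countP (fun z => z.1 = i) ≤ a i) ∧
  ∀ z ∈ μ, 1 ≤ z.2 ∧ ((z.1 = 0 ∧ z.2 ≤ N) ∨ (z.1 ∈ Finset.Icc 1 m ∧ z.2 + a z.1 ≤ bc c U z.1))

def BijP {α β : Type*} (F : α → Prop) (S : β → Prop) (f : α → β) : Prop :=
  (∀ B, F B → S (f B)) ∧ (∀ B B', F B → F B' → f B = f B' → B = B') ∧ ∀ μ, S μ → ∃ B, F B ∧ f B = μ

theorem bij_assemble {β : Type*} (v : V) (x : β)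
    (F F0 F1 : Finset V → Prop) (S S0 S1 : Multiset β → Prop) (f f0 f1 : Finset V → Multiset β)
    (hF0 : ∀ B, v ∉ B → (F B ↔ F0 B)) (hF0' : ∀ B, F0 B → v ∉ B) (hf0 : ∀ B, F0 B → f B = f0 B)
    (hF1 : ∀ B, v ∉ B → (F (insert v B) ↔ F1 B)) (hF1' : ∀ B, F1 B → v ∉ B)
    (hf1 : ∀ B, F1 B → f (insert v B) = x ::ₘ f1 B)
    (hS0 : ∀ μ, S0 μ ↔ S μ ∧ x ∉ μ) (hS1 : ∀ μ, S1 μ ↔ S (x ::ₘ μ))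
    (b0 : BijP F0 S0 f0) (b1 : BijP F1 S1 f1) : BijP F S f := by
  have cases : ∀ B, F B → F0 B ∨ ∃ B1, F1 B1 ∧ B = insert v B1 := by
    intro B hB
    by_cases hv : v ∈ B
    · right
      refine ⟨B.erase v, ?_, (Finset.insert_erase hv).symm⟩
      rw [← hF1 _ (Finset.notMem_erase v B), Finset.insert_erase hv]; exact hB
    · left; exact (hF0 B hv).1 hB
  have nx : ∀ B, F0 B → x ∉ f B := by
    intro B hB
    rw [hf0 B hB]
    exact ((hS0 _).1 (b0.1 B hB)).2
  refine ⟨?_, ?_, ?_⟩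
  · intro B hB
    rcases cases B hB with h | ⟨B1, h, rfl⟩
    · rw [hf0 B h]; exact ((hS0 _).1 (b0.1 B h)).1
    · rw [hf1 B1 h]; exact (hS1 _).1 (b1.1 B1 h)
  · intro B B' hB hB' he
    rcases cases B hB with h | ⟨B1, h, rfl⟩ <;> rcases cases B' hB' with h' | ⟨B1', h', rfl⟩
    · rw [hf0 B h, hf0 B' h'] at he
      exact b0.2.1 B B' h h' he
    · exact absurd (by rw [he, hf1 B1' h']; exact Multiset.mem_cons_self _ _) (nx B h)
    · exact absurd (by rw [← he, hf1 B1 h]; exact Multiset.mem_cons_self _ _) (nx B' h')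
    · rw [hf1 B1 h, hf1 B1' h', Multiset.cons_inj_right] at he
      rw [b1.2.1 B1 B1' h h' he]
  · intro μ hμ
    by_cases hx : x ∈ μ
    · obtain ⟨ν, rfl⟩ := Multiset.exists_cons_of_mem hx
      obtain ⟨B, hB, he⟩ := b1.2.2 ν ((hS1 ν).2 hμ)
      exact ⟨insert v B, (hF1 B (hF1' B hB)).2 hB, by rw [hf1 B hB, he]⟩
    · obtain ⟨B, hB, he⟩ := b0.2.2 μ ((hS0 μ).2 ⟨hμ, hx⟩)
      exact ⟨B, (hF0 B (hF0' B hB)).2 hB, by rw [hf0 B hB, he]⟩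

theorem bc_insert (c : V → ℕ) (B : Finset V) (v : V) (hv : v ∉ B) (l : ℕ) :
    bc c (insert v B) l = bc c B l + if c v = l then 1 else 0 := by
  unfold bc
  rw [Finset.filter_insert]
  split_ifs with h
  · rw [Finset.card_insert_of_notMem]
    simp [hv]
  · simp

theorem bc_erase (c : V → ℕ) (B : Finset V) (v : V) (hv : v ∈ B) (l : ℕ) :
    bc c (B.erase v) l + (if c v = l then 1 else 0) = bc c B l := by
  rw [← bc_insert c (B.erase v) v (Finset.notMem_erase v B), Finset.insert_erase hv]

theorem bc_mono (c : V → ℕ) {B B' : Finset V} (h : B ⊆ B') (l : ℕ) : bc c B l ≤ bc c B' l :=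
  Finset.card_le_card (Finset.filter_subset_filter _ h)

theorem card_eq_bc (c : V → ℕ) (m : ℕ) (hc : ∀ v, 1 ≤ c v ∧ c v ≤ m) (B : Finset V) :
    B.card = ∑ i ∈ Finset.Icc 1 m, bc c B i :=
  Finset.card_eq_sum_card_fiberwise (fun v _ => by simp [hc v])

theorem vr_congr {c : V → ℕ} {a a' : ℕ → ℕ} {m : ℕ} {B B' : Finset V} {w : V}
    (hg : ∀ l, gp c a B l = gp c a' B' l) (ht : tt c B w = tt c B' w) :
    vr c a m B w = vr c a' m B' w := by
  simp only [vr, Gs, hg, ht]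

theorem Phi_insert {c : V → ℕ} {a : ℕ → ℕ} {m : ℕ} {B : Finset V} {v : V} (hv : v ∉ B)
    (hmax : ∀ w ∈ B, c w = c v → w < v) (x : ℕ × ℕ) (hx : vr c a m (insert v B) v = x)
    (hx0 : x ≠ (0, 0)) :
    Phi c a m (insert v B) = x ::ₘ Phi c (Function.update a (c v) (a (c v) - 1)) m B := by
  unfold Phi
  rw [Finset.insert_val_of_notMem hv, Multiset.map_cons, hx, Multiset.filter_cons_of_pos (p := fun z => z ≠ (0, 0)) _ hx0]
  congr 2
  refine Multiset.map_congr rfl fun w hw => ?_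
  apply vr_congr
  · intro l
    simp only [gp, bc_insert c B v hv]
    by_cases h : c v = l
    · subst h; simp; omega
    · simp [h, Ne.symm h]
  · unfold tt tset
    congr 1
    ext z
    simp only [Finset.mem_filter, Finset.mem_univ, true_and, Finset.mem_insert]
    constructor
    · rintro ⟨h1, h2, h3⟩; exact ⟨h1, h2, fun h => h3 (Or.inr h)⟩
    · rintro ⟨h1, h2, h3⟩
      refine ⟨h1, h2, ?_⟩
      rintro (rfl | h)
      · exact lt_asymm h2 (hmax w hw h1.symm)
      · exact h3 h

theorem tt_max {c : V → ℕ} {U B : Finset V} {v : V}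
    (hU : ∀ u ∈ U, ∀ w, c w = c u → w < u → w ∈ U) (hvU : v ∈ U) (hBU : B ⊆ U) (hv : v ∉ B)
    (hmax : ∀ w ∈ U, c w = c v → w ≤ v) :
    tt c (insert v B) v + bc c B (c v) + 1 = bc c U (c v) := by
  have e : bc c (U.erase v) (c v) + 1 = bc c U (c v) := by
    simpa using bc_erase c U v hvU (c v)
  rw [← e]
  congr 1
  unfold tt tset bc
  rw [← Finset.card_union_of_disjoint]
  · congr 1
    ext z
    simp only [Finset.mem_union, Finset.mem_filter, Finset.mem_univ, true_and, Finset.mem_insert,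
      Finset.mem_erase]
    constructor
    · rintro (⟨h1, h2, h3⟩ | ⟨h1, h2⟩)
      · exact ⟨⟨h2.ne, hU v hvU z h1 h2⟩, h1⟩
      · refine ⟨⟨?_, hBU h1⟩, h2⟩
        rintro rfl; exact hv h1
    · rintro ⟨⟨h1, h2⟩, h3⟩
      by_cases hz : z ∈ B
      · exact Or.inr ⟨hz, h3⟩
      · refine Or.inl ⟨h3, lt_of_le_of_ne (hmax z h2 h3) h1, ?_⟩
        tauto
  · rw [Finset.disjoint_left]
    intro z hz hz'
    simp only [Finset.mem_filter, Finset.mem_univ, true_and, Finset.mem_insert] at hz hz'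
    tauto

theorem Fac_insert {c : V → ℕ} {a : ℕ → ℕ} {m d : ℕ} {U B : Finset V} {v : V}
    (hvU : v ∈ U) (hv : v ∉ B) (hd : 1 ≤ d) (ha : 1 ≤ a (c v)) :
    Fac c a m U d (insert v B) ↔
      Fac c (Function.update a (c v) (a (c v) - 1)) m (U.erase v) (d - 1) B := by
  unfold Fac
  rw [Finset.card_insert_of_notMem hv]
  refine and_congr ?_ (and_congr (by omega) ?_)
  · rw [Finset.insert_subset_iff, Finset.subset_erase]; tauto
  · refine forall_congr' fun i => forall_congr' fun _ => ?_
    rw [bc_insert c B v hv]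
    by_cases h : c v = i
    · subst h; simp; omega
    · simp [h, Ne.symm h]

theorem bij_zero (c : V → ℕ) (a : ℕ → ℕ) (m N : ℕ) (U : Finset V) :
    BijP (Fac c a m U 0) (Smon c a m U 0 N) (Phi c a m) := by
  have hF : ∀ B, Fac c a m U 0 B → B = ∅ := fun B h => Finset.card_eq_zero.1 h.2.1
  refine ⟨?_, ?_, ?_⟩
  · intro B hB
    rw [hF B hB]
    simp [Smon, Phi]
  · intro B B' h h' _
    rw [hF B h, hF B' h']
  · intro μ hμ
    have : μ = 0 := by
      have := hμ.1
      simpa using this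
    subst this
    exact ⟨∅, by simp [Fac, bc], by simp [Phi]⟩

theorem sum_gp {c : V → ℕ} {a : ℕ → ℕ} {m d N : ℕ} (hc : ∀ v, 1 ≤ c v ∧ c v ≤ m) {B : Finset V}
    (hN : d + N = ∑ i ∈ Finset.Icc 1 m, a i) (hd : B.card = d)
    (ha : ∀ i ∈ Finset.Icc 1 m, bc c B i ≤ a i) : ∑ i ∈ Finset.Icc 1 m, gp c a B i = N := by
  have h1 : ∑ i ∈ Finset.Icc 1 m, (gp c a B i + bc c B i) = ∑ i ∈ Finset.Icc 1 m, a i := by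
    refine Finset.sum_congr rfl fun i hi => ?_
    have := ha i hi
    unfold gp; omega
  rw [Finset.sum_add_distrib, ← card_eq_bc c m hc B] at h1
  omega

theorem sum_update_pred {a : ℕ → ℕ} {m i : ℕ} (hi : i ∈ Finset.Icc 1 m) (ha : 1 ≤ a i) :
    ∑ j ∈ Finset.Icc 1 m, Function.update a i (a i - 1) j + 1 = ∑ j ∈ Finset.Icc 1 m, a j := by
  rw [Finset.sum_update_of_mem hi, ← Finset.add_sum_erase _ _ hi, Finset.sdiff_singleton_eq_erase]
  omega

theorem bij_caseN {c : V → ℕ} {a : ℕ → ℕ} {m d : ℕ} (hc : ∀ v, 1 ≤ c v ∧ c v ≤ m) {U : Finset V}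
    (hN : d + 0 = ∑ i ∈ Finset.Icc 1 m, a i) (hU : ∀ u ∈ U, ∀ w, c w = c u → w < u → w ∈ U)
    (ha : ∀ i ∈ Finset.Icc 1 m, bc c U i = a i) :
    BijP (Fac c a m U d) (Smon c a m U d 0) (Phi c a m) := by
  have hUd : U.card = d := by
    rw [card_eq_bc c m hc U, Finset.sum_congr rfl ha]; exact hN.symm
  have hF : ∀ B, Fac c a m U d B ↔ B = U := by
    intro B
    constructor
    · intro h
      exact Finset.eq_of_subset_of_card_le h.1 (by rw [hUd, h.2.1])
    · rintro rfl
      exact ⟨subset_rfl, hUd, fun i hi => (ha i hi).le⟩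
  have hPhi : Phi c a m U = 0 := by
    unfold Phi
    rw [Multiset.filter_eq_nil]
    intro z hz
    obtain ⟨w, hw, rfl⟩ := Multiset.mem_map.1 hz
    have ht : tt c U w = 0 := by
      unfold tt tset
      rw [Finset.card_eq_zero, Finset.filter_eq_empty_iff]
      rintro z - ⟨h1, h2, h3⟩
      exact h3 (hU w hw z h1 h2)
    have hG : Gs c a m U (c w) = 0 := by
      unfold Gs gp
      apply Finset.sum_eq_zero
      intro j hj
      rw [Finset.mem_Ioc] at hj
      rw [ha j (by rw [Finset.mem_Icc]; have := hc w; omega)]; omega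
    simp [vr, ht, hG]
  refine ⟨?_, ?_, ?_⟩
  · intro B hB
    rw [(hF B).1 hB, hPhi]
    simp [Smon]
  · intro B B' h h' _
    rw [(hF B).1 h, (hF B').1 h']
  · intro μ hμ
    refine ⟨U, (hF U).2 rfl, ?_⟩
    rw [hPhi]
    symm
    rw [Multiset.eq_zero_iff_forall_notMem]
    intro z hz
    obtain ⟨h1, h2 | h2⟩ := hμ.2.2 z hz
    · omega
    · have := ha _ h2.1
      omega


theorem Fac_erase {c : V → ℕ} {a : ℕ → ℕ} {m d : ℕ} {U B : Finset V} {v : V} (hv : v ∉ B) :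
    Fac c a m U d B ↔ Fac c a m (U.erase v) d B := by
  unfold Fac
  rw [Finset.subset_erase]; tauto

theorem down_erase {c : V → ℕ} {U : Finset V} {v : V}
    (hU : ∀ u ∈ U, ∀ w, c w = c u → w < u → w ∈ U) (hmax : ∀ w ∈ U, c w = c v → w ≤ v) :
    ∀ u ∈ U.erase v, ∀ w, c w = c u → w < u → w ∈ U.erase v := by
  intro u hu w h1 h2
  rw [Finset.mem_erase] at hu ⊢
  refine ⟨?_, hU u hu.2 w h1 h2⟩
  rintro rfl
  exact absurd (hmax u hu.2 h1.symm) (not_le.2 h2)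

theorem bij_main {c : V → ℕ} {m : ℕ} (hc : ∀ v, 1 ≤ c v ∧ c v ≤ m)
    (hord : ∀ v w : V, c v < c w → w < v) :
    ∀ (k : ℕ) (U : Finset V), U.card = k → (∀ u ∈ U, ∀ w, c w = c u → w < u → w ∈ U) →
    ∀ (a : ℕ → ℕ) (d N : ℕ), d + N = ∑ i ∈ Finset.Icc 1 m, a i →
    (∀ i ∈ Finset.Icc 1 m, a i ≤ bc c U i) →
    BijP (Fac c a m U d) (Smon c a m U d N) (Phi c a m) := by
  intro k
  induction k with
  | zero =>
    intro U hU0 hU a d N hN ha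
    have hUe : U = ∅ := Finset.card_eq_zero.1 hU0
    have h0 : ∑ i ∈ Finset.Icc 1 m, a i = 0 := by
      apply Finset.sum_eq_zero
      intro i hi
      have := ha i hi
      rw [hUe] at this
      simpa [bc] using this
    have hd : d = 0 := by omega
    subst hd
    exact bij_zero c a m N U
  | succ k ih =>
    intro U hUk hU a d N hN ha
    rcases Nat.eq_zero_or_pos d with hd | hd
    · subst hd; exact bij_zero c a m N U
    by_cases hA : ∃ i ∈ Finset.Icc 1 m, a i < bc c U i
    · obtain ⟨i, hi, hai⟩ := hA
      have hne : (U.filter (fun v => c v = i)).Nonempty := by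
        rw [← Finset.card_pos]; unfold bc at hai; omega
      obtain ⟨v, hvmem, hvmax⟩ := Finset.exists_max_image _ id hne
      rw [Finset.mem_filter] at hvmem
      obtain ⟨hvU, rfl⟩ := hvmem
      have hmax : ∀ w ∈ U, c w = c v → w ≤ v := fun w hw h =>
        hvmax w (Finset.mem_filter.2 ⟨hw, h⟩)
      have hbcE : ∀ l, bc c (U.erase v) l + (if c v = l then 1 else 0) = bc c U l :=
        bc_erase c U v hvU
      have hUE := down_erase hU hmax
      have hcard : (U.erase v).card = k := by rw [Finset.card_erase_of_mem hvU]; omega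
      have b0 := ih (U.erase v) hcard hUE a d N hN (by
        intro l hl
        have h1 := hbcE l
        have h2 := ha l hl
        split_ifs at h1 with h
        · subst h; omega
        · omega)
      have hS0 : ∀ μ, Smon c a m (U.erase v) d N μ ↔
          Smon c a m U d N μ ∧ (c v, bc c U (c v) - a (c v)) ∉ μ := by
        intro μ
        unfold Smon
        constructor
        · rintro ⟨h1, h2, h3⟩
          refine ⟨⟨h1, h2, ?_⟩, ?_⟩
          · intro z hz
            obtain ⟨h4, h5 | h5⟩ := h3 z hz
            · exact ⟨h4, Or.inl h5⟩
            · have := hbcE z.1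
              exact ⟨h4, Or.inr ⟨h5.1, by omega⟩⟩
          · intro hz
            obtain ⟨h4, h5 | h5⟩ := h3 _ hz
            · have := hc v; simp only at h5; omega
            · have := hbcE (c v); simp at this; simp only at h5; omega
        · rintro ⟨⟨h1, h2, h3⟩, hx⟩
          refine ⟨h1, h2, ?_⟩
          intro z hz
          obtain ⟨h4, h5 | h5⟩ := h3 z hz
          · exact ⟨h4, Or.inl h5⟩
          · refine ⟨h4, Or.inr ⟨h5.1, ?_⟩⟩
            have := hbcE z.1
            split_ifs at this with h
            · have hne : z.2 ≠ bc c U (c v) - a (c v) := by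
                intro e
                apply hx
                rw [← e, h]; exact hz
              rw [← h] at h5 this ⊢
              omega
            · omega
      rcases Nat.eq_zero_or_pos (a (c v)) with hav | hav
      · refine bij_assemble v (c v, bc c U (c v) - a (c v)) _ (Fac c a m (U.erase v) d)
          (fun _ => False) _ (Smon c a m (U.erase v) d N) (fun _ => False) _ (Phi c a m)
          (fun _ => 0)
          (fun B hB => Fac_erase hB) (fun B hB h => (Finset.mem_erase.1 (hB.1 h)).1 rfl)
          (fun B _ => rfl) ?_ (fun _ h => h.elim) (fun _ h => h.elim) hS0 ?_ b0
          ⟨fun _ h => h.elim, fun _ _ h => h.elim, fun _ h => h.elim⟩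
        · intro B hB
          refine ⟨fun h => ?_, fun h => h.elim⟩
          have := h.2.2 _ hi
          rw [bc_insert c B v hB] at this
          simp at this; omega
        · intro μ
          refine ⟨fun h => h.elim, fun h => ?_⟩
          have := h.2.1 _ hi
          rw [Multiset.countP_cons] at this
          simp at this; omega
      · have b1 := ih (U.erase v) hcard hUE (Function.update a (c v) (a (c v) - 1)) (d - 1) N
          (by have := sum_update_pred hi hav; omega) (by
            intro l hl
            have h1 := hbcE l
            have h2 := ha l hl
            by_cases h : c v = l
            · subst h; simp at h1 ⊢; omega
            · simp [h, Ne.symm h] at h1 ⊢; omega)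
        refine bij_assemble v (c v, bc c U (c v) - a (c v)) _ _ _ _ _ _ _ _ _
          (fun B hB => Fac_erase hB) (fun B hB h => (Finset.mem_erase.1 (hB.1 h)).1 rfl)
          (fun B _ => rfl) (fun B hB => Fac_insert hvU hB hd hav)
          (fun B hB h => (Finset.mem_erase.1 (hB.1 h)).1 rfl) ?_ hS0 ?_ b0 b1
        · intro B hB
          have hBU : B ⊆ U := hB.1.trans (Finset.erase_subset _ _)
          have hvB : v ∉ B := fun h => (Finset.mem_erase.1 (hB.1 h)).1 rfl
          apply Phi_insert hvB
          · intro w hw hwc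
            refine lt_of_le_of_ne (hmax w (hBU hw) hwc) ?_
            rintro rfl; exact hvB hw
          · have h1 := tt_max hU hvU hBU hvB hmax
            have h2 := hB.2.2 (c v) hi
            simp only [Function.update_self] at h2
            have h3 : gp c a (insert v B) (c v) = a (c v) - 1 - bc c B (c v) := by
              unfold gp; rw [bc_insert c B v hvB]; simp; omega
            unfold vr
            rw [if_pos (by rw [h3]; omega), h3]
            congr 1; omega
          · have := hc v
            intro h
            rw [Prod.mk.injEq] at h
            omega
        · intro μ
          unfold Smon
          simp only [Multiset.card_cons, Multiset.countP_cons, Multiset.mem_cons]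
          constructor
          · rintro ⟨h1, h2, h3⟩
            refine ⟨by omega, ?_, ?_⟩
            · intro l hl
              have := h2 l hl
              by_cases h : c v = l
              · subst h; simp at this ⊢; omega
              · simpa [h, Ne.symm h] using this
            · rintro z (rfl | hz)
              · refine ⟨by simp only; omega, Or.inr ⟨hi, by simp only; omega⟩⟩
              · obtain ⟨h4, h5 | h5⟩ := h3 z hz
                · exact ⟨h4, Or.inl h5⟩
                · refine ⟨h4, Or.inr ⟨h5.1, ?_⟩⟩
                  have h6 := hbcE z.1
                  have h7 := h5.2
                  by_cases h : c v = z.1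
                  · rw [← h] at h6 h7 ⊢; simp at h6 h7; omega
                  · simp [h, Ne.symm h] at h6 h7; omega
          · rintro ⟨h1, h2, h3⟩
            refine ⟨by omega, ?_, ?_⟩
            · intro l hl
              have := h2 l hl
              by_cases h : c v = l
              · subst h; simp at this ⊢; omega
              · simpa [h, Ne.symm h] using this
            · intro z hz
              obtain ⟨h4, h5 | h5⟩ := h3 z (Or.inr hz)
              · exact ⟨h4, Or.inl h5⟩
              · refine ⟨h4, Or.inr ⟨h5.1, ?_⟩⟩
                have h6 := hbcE z.1
                have h7 := h5.2
                by_cases h : c v = z.1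
                · rw [← h] at h6 h7 ⊢; simp at h6 ⊢; omega
                · simp [h, Ne.symm h] at h6 ⊢; omega
    · push Not at hA
      have haU : ∀ i ∈ Finset.Icc 1 m, bc c U i = a i := fun i hi => le_antisymm (hA i hi) (ha i hi)
      rcases Nat.eq_zero_or_pos N with hN0 | hNp
      · subst hN0
        exact bij_caseN hc hN hU haU
      have hne : U.Nonempty := by rw [← Finset.card_pos]; omega
      obtain ⟨v, hvU, hvmax⟩ := Finset.exists_max_image U id hne
      simp only [id] at hvmax
      have hi : c v ∈ Finset.Icc 1 m := by simp [hc v]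
      have hmax : ∀ w ∈ U, c w = c v → w ≤ v := fun w hw _ => hvmax w hw
      have hcol : ∀ w ∈ U, c v ≤ c w := by
        intro w hw
        by_contra h
        exact absurd (hvmax w hw) (not_le.2 (hord _ _ (not_le.1 h)))
      have hbcE : ∀ l, bc c (U.erase v) l + (if c v = l then 1 else 0) = bc c U l :=
        bc_erase c U v hvU
      have hUE := down_erase hU hmax
      have hcard : (U.erase v).card = k := by rw [Finset.card_erase_of_mem hvU]; omega
      have hav : 1 ≤ a (c v) := by
        have := hbcE (c v)
        rw [haU _ hi] at this
        simp at this; omega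
      have hsum := sum_update_pred hi hav
      have haE : ∀ l ∈ Finset.Icc 1 m,
          bc c (U.erase v) l = Function.update a (c v) (a (c v) - 1) l := by
        intro l hl
        have h1 := hbcE l
        rw [haU l hl] at h1
        by_cases h : c v = l
        · subst h; simp at h1 ⊢; omega
        · simp [h, Ne.symm h] at h1 ⊢; omega
      have b0 := ih (U.erase v) hcard hUE (Function.update a (c v) (a (c v) - 1)) d (N - 1)
        (by omega) (fun l hl => (haE l hl).ge)
      have b1 := ih (U.erase v) hcard hUE (Function.update a (c v) (a (c v) - 1)) (d - 1) N
        (by omega) (fun l hl => (haE l hl).ge)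
      have hbound : ∀ B ⊆ U, v ∉ B → bc c B (c v) ≤ a (c v) - 1 := by
        intro B hB hvB
        have h1 := bc_mono c (Finset.subset_erase.2 ⟨hB, hvB⟩ : B ⊆ U.erase v) (c v)
        rw [haE _ hi] at h1
        simpa using h1
      have hS : ∀ d' N' μ, Smon c a m U d' N' μ ↔
          (Multiset.card μ ≤ d' ∧ ∀ z ∈ μ, 1 ≤ z.2 ∧ z.1 = 0 ∧ z.2 ≤ N') := by
        intro d' N' μ
        unfold Smon
        constructor
        · rintro ⟨h1, h2, h3⟩
          refine ⟨h1, fun z hz => ?_⟩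
          obtain ⟨h4, h5 | h5⟩ := h3 z hz
          · exact ⟨h4, h5⟩
          · have := haU _ h5.1; omega
        · rintro ⟨h1, h3⟩
          refine ⟨h1, ?_, fun z hz => ⟨(h3 z hz).1, Or.inl (h3 z hz).2⟩⟩
          intro l hl
          rw [Multiset.countP_eq_zero.2]
          · omega
          · intro z hz e
            have := h3 z hz
            rw [Finset.mem_Icc] at hl
            omega
      have hS' : ∀ d' N' μ, Smon c (Function.update a (c v) (a (c v) - 1)) m (U.erase v) d' N' μ ↔
          (Multiset.card μ ≤ d' ∧ ∀ z ∈ μ, 1 ≤ z.2 ∧ z.1 = 0 ∧ z.2 ≤ N') := by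
        intro d' N' μ
        unfold Smon
        constructor
        · rintro ⟨h1, h2, h3⟩
          refine ⟨h1, fun z hz => ?_⟩
          obtain ⟨h4, h5 | h5⟩ := h3 z hz
          · exact ⟨h4, h5⟩
          · have := haE _ h5.1; omega
        · rintro ⟨h1, h3⟩
          refine ⟨h1, ?_, fun z hz => ⟨(h3 z hz).1, Or.inl (h3 z hz).2⟩⟩
          intro l hl
          rw [Multiset.countP_eq_zero.2]
          · omega
          · intro z hz e
            have := h3 z hz
            rw [Finset.mem_Icc] at hl
            omega
      refine bij_assemble v (0, N) _ _ _ _ _ _ _ _ _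
          ?_ (fun B hB h => (Finset.mem_erase.1 (hB.1 h)).1 rfl)
          ?_ (fun B hB => Fac_insert hvU hB hd hav)
          (fun B hB h => (Finset.mem_erase.1 (hB.1 h)).1 rfl) ?_ ?_ ?_ b0 b1
      · intro B hB
        rw [Fac_erase hB]
        unfold Fac
        refine and_congr_right fun hBU => and_congr_right fun _ => ?_
        refine forall_congr' fun l => forall_congr' fun hl => ?_
        by_cases h : c v = l
        · subst h
          have := hbound B (hBU.trans (Finset.erase_subset _ _)) hB
          simp; omega
        · simp [Ne.symm h]
      · intro B hB
        have hBU : B ⊆ U := hB.1.trans (Finset.erase_subset _ _)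
        have hvB : v ∉ B := fun h => (Finset.mem_erase.1 (hB.1 h)).1 rfl
        unfold Phi
        congr 1
        refine Multiset.map_congr rfl fun w hw => ?_
        have hwU := hBU hw
        have hGs : ∀ l, c v ≤ l →
            Gs c a m B l = Gs c (Function.update a (c v) (a (c v) - 1)) m B l := by
          intro l hl
          unfold Gs gp
          refine Finset.sum_congr rfl fun j hj => ?_
          rw [Finset.mem_Ioc] at hj
          rw [Function.update_of_ne (by omega)]
        by_cases h : c w = c v
        · have hle : tt c B w ≤ a (c v) - 1 - bc c B (c v) := by
            have h1 : tt c B w + bc c B (c v) ≤ bc c (U.erase v) (c v) := by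
              unfold tt tset bc
              rw [← Finset.card_union_of_disjoint]
              · apply Finset.card_le_card
                intro z hz
                simp only [Finset.mem_union, Finset.mem_filter, Finset.mem_univ, true_and] at hz
                rw [Finset.mem_filter]
                rcases hz with ⟨h1, h2, h3⟩ | ⟨h1, h2⟩
                · refine ⟨hUE w (hB.1 hw) z h1 h2, h1.trans h⟩
                · exact ⟨hB.1 h1, h2⟩
              · rw [Finset.disjoint_left]
                intro z hz hz'
                simp only [Finset.mem_filter, Finset.mem_univ, true_and] at hz hz'
                tauto
            rw [haE _ hi] at h1
            simp at h1; omega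
          unfold vr
          rw [if_neg, if_neg, hGs _ (hcol w hwU)]
          · rw [h]; unfold gp; simp; omega
          · rw [h]; unfold gp; omega
        · unfold vr
          rw [hGs _ (hcol w hwU)]
          unfold gp
          rw [Function.update_of_ne h]
      · intro B hB
        have hBU : B ⊆ U := hB.1.trans (Finset.erase_subset _ _)
        have hvB : v ∉ B := fun h => (Finset.mem_erase.1 (hB.1 h)).1 rfl
        apply Phi_insert hvB
        · intro w hw hwc
          refine lt_of_le_of_ne (hmax w (hBU hw) hwc) ?_
          rintro rfl; exact hvB hw
        · have hFac := (Fac_insert hvU hvB hd hav).2 hB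
          have h1 := tt_max hU hvU hBU hvB hmax
          rw [haU _ hi] at h1
          have h3 : gp c a (insert v B) (c v) = tt c (insert v B) v := by
            unfold gp; rw [bc_insert c B v hvB]; simp; omega
          unfold vr
          rw [if_neg (by omega)]
          congr 1
          have h4 := sum_gp hc hN hFac.2.1 hFac.2.2
          rw [← h3, ← h4]
          unfold Gs
          rw [← Finset.sum_insert (by simp)]
          apply Finset.sum_subset
          · intro l hl
            have := hc v
            simp only [Finset.mem_insert, Finset.mem_Ioc, Finset.mem_Icc] at hl ⊢
            omega
          · intro l hl hl'
            simp only [Finset.mem_insert, Finset.mem_Ioc, Finset.mem_Icc] at hl hl'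
            have : a l = 0 := by
              rw [← haU l (Finset.mem_Icc.2 hl)]
              unfold bc
              rw [Finset.card_eq_zero, Finset.filter_eq_empty_iff]
              intro w hw e
              have := hcol w hw
              omega
            unfold gp; omega
        · intro h
          rw [Prod.mk.injEq] at h
          omega
      · intro μ
        rw [hS, hS']
        constructor
        · rintro ⟨h1, h2⟩
          refine ⟨⟨h1, fun z hz => ?_⟩, fun hz => ?_⟩
          · have := h2 z hz; omega
          · have := h2 _ hz; simp only at this; omega
        · rintro ⟨⟨h1, h2⟩, h3⟩
          refine ⟨h1, fun z hz => ?_⟩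
          have h4 := h2 z hz
          have : z.2 ≠ N := by
            intro e
            apply h3
            rw [← e, ← h4.2.1]; exact hz
          omega
      · intro μ
        rw [hS, hS']
        simp only [Multiset.card_cons, Multiset.mem_cons]
        constructor
        · rintro ⟨h1, h2⟩
          refine ⟨by omega, ?_⟩
          rintro z (rfl | hz)
          · exact ⟨hNp, rfl, le_rfl⟩
          · exact h2 z hz
        · rintro ⟨h1, h2⟩
          exact ⟨by omega, fun z hz => h2 z (Or.inr hz)⟩


def Low (y x : ℕ × ℕ) : Prop := (y.1 = x.1 ∧ y.2 ≤ x.2) ∨ (y.1 = 0 ∧ x.1 ≠ 0)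

theorem vr_low {c : V → ℕ} {a : ℕ → ℕ} {m : ℕ} {B B' : Finset V} {w w' : V} (hc : c w ≠ 0)
    (h1 : gp c a B' (c w') < tt c B' w' → c w' = c w ∧ gp c a B (c w) < tt c B w ∧
      tt c B' w' - gp c a B' (c w') ≤ tt c B w - gp c a B (c w))
    (h2 : ¬ gp c a B' (c w') < tt c B' w' → gp c a B (c w) < tt c B w ∨
      tt c B' w' + Gs c a m B' (c w') ≤ tt c B w + Gs c a m B (c w)) :
    Low (vr c a m B' w') (vr c a m B w) := by
  unfold vr
  by_cases h : gp c a B' (c w') < tt c B' w'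
  · obtain ⟨e1, e2, e3⟩ := h1 h
    rw [if_pos h, if_pos e2]
    exact Or.inl ⟨e1, e3⟩
  · rw [if_neg h]
    by_cases h' : gp c a B (c w) < tt c B w
    · rw [if_pos h']
      exact Or.inr ⟨rfl, hc⟩
    · rw [if_neg h']
      exact Or.inl ⟨rfl, (h2 h).resolve_left h'⟩

theorem tt_insert (c : V → ℕ) (C : Finset V) (u w : V) (hu : u ∉ C) :
    tt c (insert u C) w + (if c u = c w ∧ u < w then 1 else 0) = tt c C w := by
  unfold tt
  split_ifs with h
  · have e : tset c C w = insert u (tset c (insert u C) w) := by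
      ext z
      simp only [tset, Finset.mem_filter, Finset.mem_univ, true_and, Finset.mem_insert]
      constructor
      · rintro ⟨h1, h2, h3⟩
        by_cases hz : z = u
        · exact Or.inl hz
        · right; tauto
      · rintro (rfl | ⟨h1, h2, h3⟩)
        · exact ⟨h.1, h.2, hu⟩
        · tauto
    rw [e, Finset.card_insert_of_notMem]
    simp [tset]
  · have e : tset c C w = tset c (insert u C) w := by
      ext z
      simp only [tset, Finset.mem_filter, Finset.mem_univ, true_and, Finset.mem_insert]
      constructor
      · rintro ⟨h1, h2, h3⟩
        refine ⟨h1, h2, ?_⟩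
        rintro (rfl | h')
        · exact h ⟨h1, h2⟩
        · exact h3 h'
      · tauto
    rw [e]; rfl

theorem tt_swap (c : V → ℕ) (B : Finset V) (u v w : V) (hu : u ∉ B) (hv : v ∈ B) :
    tt c (insert u (B.erase v)) w + (if c u = c w ∧ u < w then 1 else 0)
      = tt c B w + (if c v = c w ∧ v < w then 1 else 0) := by
  rw [tt_insert c _ u w (fun h => hu (Finset.mem_of_mem_erase h))]
  have := tt_insert c (B.erase v) v w (Finset.notMem_erase v B)
  rw [Finset.insert_erase hv] at this
  exact this.symm

theorem bc_swap (c : V → ℕ) (B : Finset V) (u v : V) (l : ℕ) (hu : u ∉ B) (hv : v ∈ B) :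
    bc c (insert u (B.erase v)) l + (if c v = l then 1 else 0)
      = bc c B l + (if c u = l then 1 else 0) := by
  rw [bc_insert c _ u (fun h => hu (Finset.mem_of_mem_erase h)), ← bc_erase c B v hv]
  omega

theorem swap_colex (B : Finset V) (u v : V) (hu : u ∉ B) (hv : v ∈ B) (huv : u < v) :
    toColex (insert u (B.erase v)) < toColex B := by
  rw [Finset.Colex.toColex_lt_toColex_iff_exists_forall_lt]
  refine ⟨v, hv, ?_, ?_⟩
  · simp [huv.ne']
  · intro b hb hb'
    rw [Finset.mem_insert, Finset.mem_erase] at hb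
    rcases hb with rfl | hb
    · exact huv
    · exact absurd hb.2 hb'

theorem swap_exists {c : V → ℕ} {a : ℕ → ℕ} {m d : ℕ} (hc : ∀ v, 1 ≤ c v ∧ c v ≤ m)
    (hord : ∀ v w : V, c v < c w → w < v) (ha : ∀ i ∈ Finset.Icc 1 m, a i ≤ bc c Finset.univ i)
    {B : Finset V} (hB : Fac c a m Finset.univ d B) {v : V} (hv : v ∈ B)
    (hvr : vr c a m B v ≠ (0, 0)) :
    ∃ u, u ∉ B ∧ u < v ∧ Fac c a m Finset.univ d (insert u (B.erase v)) ∧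
      Low (vr c a m (insert u (B.erase v)) u) (vr c a m B v) ∧
      ∀ w ∈ B.erase v, Low (vr c a m (insert u (B.erase v)) w) (vr c a m B w) := by
  have hFacc : ∀ u, u ∉ B → (∀ i ∈ Finset.Icc 1 m, bc c (insert u (B.erase v)) i ≤ a i) →
      Fac c a m Finset.univ d (insert u (B.erase v)) := by
    intro u hu h
    refine ⟨Finset.subset_univ _, ?_, h⟩
    rw [Finset.card_insert_of_notMem (fun h => hu (Finset.mem_of_mem_erase h)),
      Finset.card_erase_add_one hv]
    exact hB.2.1
  have hc0 : ∀ w, c w ≠ 0 := fun w => by have := hc w; omega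
  by_cases ht : tt c B v = 0
  · -- move to another color
    have hG : Gs c a m B (c v) ≠ 0 := by
      intro h
      apply hvr
      simp [vr, ht, h]
    obtain ⟨j, hj, hgj⟩ : ∃ j ∈ Finset.Ioc (c v) m, gp c a B j ≠ 0 := by
      by_contra hcon
      push Not at hcon
      exact hG (Finset.sum_eq_zero hcon)
    rw [Finset.mem_Ioc] at hj
    have hjm : j ∈ Finset.Icc 1 m := by rw [Finset.mem_Icc]; omega
    have hne : (Finset.univ.filter (fun w => c w = j ∧ w ∉ B)).Nonempty := by
      by_contra hcon
      rw [Finset.not_nonempty_iff_eq_empty, Finset.filter_eq_empty_iff] at hcon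
      have h1 := ha j hjm
      have h2 : bc c Finset.univ j ≤ bc c B j := by
        apply Finset.card_le_card
        intro w hw
        rw [Finset.mem_filter] at hw ⊢
        refine ⟨?_, hw.2⟩
        by_contra hwB
        exact hcon (Finset.mem_univ w) ⟨hw.2, hwB⟩
      unfold gp at hgj
      omega
    obtain ⟨u, hu, humin⟩ := Finset.exists_min_image _ id hne
    rw [Finset.mem_filter] at hu
    obtain ⟨-, rfl, huB⟩ := hu
    have htu0 : ∀ w, c w = c u → ¬ u < w → tt c B w = 0 := by
      intro w h1 h2
      unfold tt tset
      rw [Finset.card_eq_zero, Finset.filter_eq_empty_iff]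
      rintro z - ⟨h3, h4, h5⟩
      have := humin z (by simp [h3, h1, h5])
      simp only [id] at this
      exact h2 (lt_of_le_of_lt this h4)
    have hbc := fun l => bc_swap c B u v l huB hv
    have hgp : ∀ l ∈ Finset.Icc 1 m, gp c a (insert u (B.erase v)) l + (if c u = l then 1 else 0)
        = gp c a B l + (if c v = l then 1 else 0) := by
      intro l hl
      have h1 := hbc l
      have h2 := hB.2.2 l hl
      unfold gp at hgj ⊢
      by_cases e1 : c u = l
      · subst e1
        have e2 : ¬ c v = c u := by omega
        simp only [e2, if_true, if_false] at h1 ⊢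
        omega
      · by_cases e2 : c v = l
        · subst e2
          simp only [e1, if_true, if_false] at h1 ⊢
          omega
        · simp only [e1, e2, if_false] at h1 ⊢
          omega
    have hGs : ∀ l, 1 ≤ l → Gs c a m (insert u (B.erase v)) l + (if l < c u then 1 else 0)
        = Gs c a m B l + (if l < c v then 1 else 0) := by
      intro l hl
      have h1 : ∑ j ∈ Finset.Ioc l m, (gp c a (insert u (B.erase v)) j + (if c u = j then 1 else 0))
          = ∑ j ∈ Finset.Ioc l m, (gp c a B j + (if c v = j then 1 else 0)) := by
        refine Finset.sum_congr rfl fun j hj => hgp j ?_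
        rw [Finset.mem_Ioc] at hj
        rw [Finset.mem_Icc]; omega
      rw [Finset.sum_add_distrib, Finset.sum_add_distrib, Finset.sum_ite_eq, Finset.sum_ite_eq] at h1
      simp only [Finset.mem_Ioc, (hc u).2, (hc v).2, and_true] at h1
      exact h1
    refine ⟨u, huB, hord _ _ hj.1, ?_, ?_, ?_⟩
    · apply hFacc u huB
      intro l hl
      have h1 := hbc l
      have h2 := hB.2.2 l hl
      unfold gp at hgj
      by_cases e1 : c u = l
      · subst e1
        simp only [if_true] at h1
        omega
      · simp only [e1, if_false] at h1
        omega
    · have h1 := tt_swap c B u v u huB hv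
      rw [htu0 u rfl (lt_irrefl u)] at h1
      have h2 : ¬ c v = c u := by omega
      simp only [h2, lt_irrefl, false_and, and_false, if_false] at h1
      apply vr_low (hc0 v)
      · intro h; omega
      · intro _
        right
        have h3 := hGs (c u) (hc u).1
        have h4 : ¬ c u < c v := by omega
        simp only [h4, lt_irrefl, if_false] at h3
        have h5 : Gs c a m B (c u) ≤ Gs c a m B (c v) := by
          unfold Gs
          apply Finset.sum_le_sum_of_subset
          exact Finset.Ioc_subset_Ioc_left hj.1.le
        omega
    · intro w hw
      rw [Finset.mem_erase] at hw
      have h1 := tt_swap c B u v w huB hv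
      have h2 := hgp (c w) (by simp [hc w])
      have h3 := hGs (c w) (hc w).1
      by_cases e1 : c w = c v
      · have e2 : ¬ c u = c w := by omega
        have e3 : c w < c u := by omega
        simp only [e2, e3, e1.symm, false_and, true_and, if_true, if_false] at h1 h2 h3
        have e5 : ¬ c w < c w := lt_irrefl _
        simp only [e5, if_false] at h3
        by_cases hlt : v < w
        · simp only [hlt, if_true] at h1
          apply vr_low (hc0 w)
          · intro h; exact ⟨rfl, by omega, by omega⟩
          · intro h; right; omega
        · simp only [hlt, if_false] at h1
          have h0 : tt c B w = 0 := by
            have hwv : w < v := lt_of_le_of_ne (not_lt.1 hlt) hw.1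
            have : tt c B w ≤ tt c B v := by
              unfold tt tset
              apply Finset.card_le_card
              intro z hz
              rw [Finset.mem_filter] at hz ⊢
              exact ⟨hz.1, hz.2.1.trans e1, hz.2.2.1.trans hwv, hz.2.2.2⟩
            omega
          apply vr_low (hc0 w)
          · intro h; omega
          · intro h; right; omega
      · have e1' : ¬ c v = c w := fun h => e1 h.symm
        by_cases e2 : c u = c w
        · have e3 : ¬ c w < c u := by omega
          have e4 : ¬ c w < c v := by omega
          simp only [e2, e1', e3, e4, false_and, true_and, if_true, if_false] at h1 h2 h3
          have e5 : ¬ c w < c w := lt_irrefl _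
          simp only [e5, if_false] at h3
          by_cases hlt : u < w
          · simp only [hlt, if_true] at h1
            apply vr_low (hc0 w)
            · intro h; exact ⟨rfl, by omega, by omega⟩
            · intro h; right; omega
          · simp only [hlt, if_false] at h1
            have h0 := htu0 w e2.symm hlt
            apply vr_low (hc0 w)
            · intro h; omega
            · intro h; right; omega
        · simp only [e2, e1', false_and, if_false] at h1 h2
          have h4 : Gs c a m (insert u (B.erase v)) (c w) ≤ Gs c a m B (c w) := by
            split_ifs at h3 <;> omega
          apply vr_low (hc0 w)
          · intro h; exact ⟨rfl, by omega, by omega⟩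
          · intro h; right; omega
  · -- move inside the color
    obtain ⟨u, hu⟩ : (tset c B v).Nonempty := by
      rw [← Finset.card_pos]; unfold tt at ht; omega
    simp only [tset, Finset.mem_filter, Finset.mem_univ, true_and] at hu
    obtain ⟨huc, huv, huB⟩ := hu
    have hbc : ∀ l, bc c (insert u (B.erase v)) l = bc c B l := by
      intro l
      have := bc_swap c B u v l huB hv
      rw [huc] at this
      omega
    have hgp : ∀ l, gp c a (insert u (B.erase v)) l = gp c a B l := by
      intro l; unfold gp; rw [hbc]
    have hGs : ∀ l, Gs c a m (insert u (B.erase v)) l = Gs c a m B l := by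
      intro l; unfold Gs; simp only [hgp]
    have key : ∀ w w', c w' = c w → tt c (insert u (B.erase v)) w' ≤ tt c B w →
        Low (vr c a m (insert u (B.erase v)) w') (vr c a m B w) := by
      intro w w' e h
      apply vr_low (hc0 w)
      · rw [hgp, e]; intro h'; exact ⟨rfl, by omega, by omega⟩
      · rw [hgp, e, hGs]; intro h'; right; omega
    refine ⟨u, huB, huv, ?_, ?_, ?_⟩
    · apply hFacc u huB
      intro l hl; rw [hbc]; exact hB.2.2 l hl
    · apply key _ _ huc
      have h1 := tt_swap c B u v u huB hv
      simp only [lt_irrefl, not_lt.2 huv.le, and_false, if_false] at h1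
      have : tt c B u ≤ tt c B v := by
        unfold tt tset
        apply Finset.card_le_card
        intro z hz
        rw [Finset.mem_filter] at hz ⊢
        exact ⟨hz.1, hz.2.1.trans huc, hz.2.2.1.trans huv, hz.2.2.2⟩
      omega
    · intro w hw
      apply key _ _ rfl
      have h1 := tt_swap c B u v w huB hv
      by_cases e : c v = c w ∧ v < w
      · rw [if_pos e, if_pos ⟨huc.trans e.1, huv.trans e.2⟩] at h1; omega
      · rw [if_neg e] at h1; omega

theorem colex_lt_of_restr {c : V → ℕ} {a : ℕ → ℕ} {m d : ℕ} (hc : ∀ v, 1 ≤ c v ∧ c v ≤ m)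
    (hord : ∀ v w : V, c v < c w → w < v) {B B' : Finset V} (hB : Fac c a m Finset.univ d B)
    (hB' : Fac c a m Finset.univ d B')
    (hR : B.filter (fun v => vr c a m B v ≠ (0, 0)) ⊆ B') (hne : B ≠ B') :
    toColex B < toColex B' := by
  by_contra hcon
  have hlt : toColex B' < toColex B := by
    refine lt_of_le_of_ne (not_lt.1 hcon) ?_
    intro h; exact hne (by simpa using h.symm)
  rw [Finset.Colex.toColex_lt_toColex_iff_exists_forall_lt] at hlt
  obtain ⟨x, hxB, hxB', hall⟩ := hlt
  have hvr : vr c a m B x = (0, 0) := by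
    by_contra h
    exact hxB' (hR (Finset.mem_filter.2 ⟨hxB, h⟩))
  have hcx := hc x
  unfold vr at hvr
  split_ifs at hvr with hif
  · rw [Prod.mk.injEq] at hvr; omega
  rw [Prod.mk.injEq] at hvr
  have ht : tt c B x = 0 := by omega
  have hG : Gs c a m B (c x) = 0 := by omega
  have hcol : ∀ w ∈ B', w ∉ B → c x < c w := by
    intro w hw hwB
    have h1 := hall w hw hwB
    by_contra h
    rcases (not_lt.1 h).lt_or_eq with h2 | h2
    · exact lt_asymm h1 (hord _ _ h2)
    · unfold tt tset at ht
      rw [Finset.card_eq_zero, Finset.filter_eq_empty_iff] at ht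
      exact ht (Finset.mem_univ w) ⟨h2, h1, hwB⟩
  have hle : ∀ l ∈ Finset.Icc 1 m, bc c B' l ≤ bc c B l := by
    intro l hl
    by_cases h : c x < l
    · have h1 := hB'.2.2 l hl
      rw [Finset.mem_Icc] at hl
      have h2 := Finset.sum_eq_zero_iff.1 hG l (by rw [Finset.mem_Ioc]; omega)
      unfold gp at h2
      omega
    · apply Finset.card_le_card
      intro w hw
      rw [Finset.mem_filter] at hw ⊢
      refine ⟨?_, hw.2⟩
      by_contra hwB
      have := hcol w hw.1 hwB
      omega
  have hlt : bc c B' (c x) < bc c B (c x) := by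
    apply Finset.card_lt_card
    rw [Finset.ssubset_iff_of_subset]
    · exact ⟨x, by simp [hxB], by simp [hxB']⟩
    · intro w hw
      rw [Finset.mem_filter] at hw ⊢
      refine ⟨?_, hw.2⟩
      by_contra hwB
      have := hcol w hw.1 hwB
      omega
  have h1 := card_eq_bc c m hc B
  have h2 := card_eq_bc c m hc B'
  have h3 : ∑ i ∈ Finset.Icc 1 m, bc c B' i < ∑ i ∈ Finset.Icc 1 m, bc c B i :=
    Finset.sum_lt_sum hle ⟨c x, by simp [hcx], hlt⟩
  rw [← h1, ← h2, hB.2.1, hB'.2.1] at h3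
  exact lt_irrefl _ h3

theorem lower_all (P : Multiset (ℕ × ℕ) → Prop) (Om : ℕ × ℕ → Prop) (hOm : ∀ y, Om y → 1 ≤ y.2)
    (hdiv : ∀ μ ν, P μ → ν ≤ μ → P ν)
    (hst : ∀ x y ν, P (x ::ₘ ν) → Om y → Low y x → P (y ::ₘ ν)) (f f' : V → ℕ × ℕ)
    (s : Multiset V) (h : ∀ w ∈ s, f' w ≠ (0, 0) → Om (f' w))
    (hl : ∀ w ∈ s, Low (f' w) (f w)) :
    ∀ ν, P ((s.map f).filter (fun z => z ≠ (0, 0)) + ν) →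
      P ((s.map f').filter (fun z => z ≠ (0, 0)) + ν) := by
  induction s using Multiset.induction_on with
  | empty => intro ν hν; simpa using hν
  | cons w s ih =>
    intro ν hν
    have ih' := ih (fun z hz => h z (Multiset.mem_cons_of_mem hz))
      (fun z hz => hl z (Multiset.mem_cons_of_mem hz))
    have hlw := hl w (Multiset.mem_cons_self _ _)
    rw [Multiset.map_cons] at hν ⊢
    by_cases e' : f' w = (0, 0)
    · rw [Multiset.filter_cons_of_neg (p := fun z => z ≠ (0, 0)) _ (by simpa using e')]
      apply ih'
      refine hdiv _ _ hν ?_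
      gcongr
      exact Multiset.le_cons_self _ _
    · have hO := h w (Multiset.mem_cons_self _ _) e'
      have e : f w ≠ (0, 0) := by
        intro e
        rw [e] at hlw
        have := hOm _ hO
        rcases hlw with h1 | h1
        · have := h1.2; simp only at this; omega
        · exact h1.2 rfl
      rw [Multiset.filter_cons_of_pos (p := fun z => z ≠ (0, 0)) _ e'] 
      rw [Multiset.filter_cons_of_pos (p := fun z => z ≠ (0, 0)) _ e] at hν
      rw [Multiset.cons_add] at hν ⊢
      have := hst _ _ _ hν hO hlw
      rw [← Multiset.add_cons] at this ⊢
      exact ih' _ this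



def pos (cx : W → ℕ) (x : W) : ℕ := (Finset.univ.filter (fun y => cx y = cx x ∧ y ≤ x)).card

theorem pos_lt {cx : W → ℕ} {x y : W} (h : cx x = cx y) (hxy : x < y) : pos cx x < pos cx y := by
  apply Finset.card_lt_card
  rw [Finset.ssubset_iff_of_subset]
  · refine ⟨y, by simp, by simp [hxy]⟩
  · intro z hz
    simp only [Finset.mem_filter, Finset.mem_univ, true_and] at hz ⊢
    exact ⟨hz.1.trans h, hz.2.trans hxy.le⟩

theorem pos_pos (cx : W → ℕ) (x : W) : 1 ≤ pos cx x :=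
  Finset.card_pos.2 ⟨x, by simp⟩

theorem pos_inj {cx : W → ℕ} {x y : W} (h : cx x = cx y) (hp : pos cx x = pos cx y) : x = y := by
  rcases lt_trichotomy x y with h1 | h1 | h1
  · have := pos_lt h h1; omega
  · exact h1
  · have := pos_lt h.symm h1; omega

theorem pos_le (cx : W → ℕ) (x : W) :
    pos cx x ≤ (Finset.univ.filter (fun y => cx y = cx x)).card := by
  apply Finset.card_le_card
  intro z hz
  simp only [Finset.mem_filter, Finset.mem_univ, true_and] at hz ⊢
  exact hz.1

theorem pos_surj (cx : W → ℕ) (i k : ℕ) (hk : 1 ≤ k)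
    (hk' : k ≤ (Finset.univ.filter (fun y => cx y = i)).card) : ∃ x, cx x = i ∧ pos cx x = k := by
  have h : (Finset.univ.filter (fun y => cx y = i)).image (pos cx) =
      Finset.Icc 1 (Finset.univ.filter (fun y => cx y = i)).card := by
    apply Finset.eq_of_subset_of_card_le
    · intro k hk
      rw [Finset.mem_image] at hk
      obtain ⟨x, hx, rfl⟩ := hk
      rw [Finset.mem_filter] at hx
      rw [Finset.mem_Icc]
      refine ⟨pos_pos cx x, ?_⟩
      have := pos_le cx x
      rwa [hx.2] at this
    · rw [Finset.card_image_of_injOn]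
      · simp
      · intro x hx y hy hxy
        simp only [Finset.coe_filter, Finset.mem_univ, true_and, Set.mem_ofPred_eq] at hx hy
        exact pos_inj (hx.trans hy.symm) hxy
  have h2 : k ∈ Finset.Icc 1 (Finset.univ.filter (fun y => cx y = i)).card := by
    rw [Finset.mem_Icc]; exact ⟨hk, hk'⟩
  rw [← h, Finset.mem_image] at h2
  obtain ⟨x, hx, rfl⟩ := h2
  exact ⟨x, (Finset.mem_filter.1 hx).2, rfl⟩

def evar (cx : W → ℕ) (x : W) : ℕ × ℕ := (cx x, pos cx x)

theorem evar_inj (cx : W → ℕ) : Function.Injective (evar cx) := by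
  intro x y h
  simp only [evar, Prod.mk.injEq] at h
  exact pos_inj h.1 h.2

noncomputable def Tm (cx : W → ℕ) (μ : W →₀ ℕ) : Multiset (ℕ × ℕ) :=
  (Finsupp.toMultiset μ).map (evar cx)

theorem Tm_inj (cx : W → ℕ) : Function.Injective (Tm cx) := by
  intro x y h
  have := Multiset.map_injective (evar_inj cx) h
  exact Finsupp.orderIsoMultiset.injective this

theorem Tm_add (cx : W → ℕ) (μ ν : W →₀ ℕ) : Tm cx (μ + ν) = Tm cx μ + Tm cx ν := by
  simp [Tm]

theorem Tm_single (cx : W → ℕ) (x : W) (k : ℕ) : Tm cx (Finsupp.single x k) = k • {evar cx x} := by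
  simp [Tm, Multiset.map_nsmul]

theorem degM_add (μ ν : W →₀ ℕ) : degM (μ + ν) = degM μ + degM ν := by
  simp [degM, Finset.sum_add_distrib]

theorem degC_add (cx : W → ℕ) (i : ℕ) (μ ν : W →₀ ℕ) :
    degC cx i (μ + ν) = degC cx i μ + degC cx i ν := by
  simp [degC, Finset.sum_add_distrib]

theorem Tm_card (cx : W → ℕ) (μ : W →₀ ℕ) : Multiset.card (Tm cx μ) = degM μ := by
  induction μ using Finsupp.induction_linear with
  | zero => simp [Tm, degM]
  | add f g hf hg => rw [Tm_add, Multiset.card_add, hf, hg, degM_add]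
  | single x k => 
    rw [Tm_single]
    simp only [Multiset.card_nsmul, Multiset.card_singleton, degM]
    rw [Finset.sum_eq_single x]
    · simp
    · intro b _ hb; simp [hb]
    · simp

theorem Tm_countP (cx : W → ℕ) (i : ℕ) (μ : W →₀ ℕ) :
    (Tm cx μ).countP (fun z => z.1 = i) = degC cx i μ := by
  induction μ using Finsupp.induction_linear with
  | zero => simp [Tm, degC]
  | add f g hf hg => rw [Tm_add, Multiset.countP_add, hf, hg, degC_add]
  | single x k => 
    rw [Tm_single, Multiset.countP_nsmul, degC, Finset.sum_filter, Finset.sum_eq_single x]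
    · rw [← Multiset.cons_zero, Multiset.countP_cons]
      by_cases h : cx x = i <;> simp [evar, h]
    · intro b _ hb; simp [hb]
    · simp

theorem Tm_mem (cx : W → ℕ) (μ : W →₀ ℕ) (z : ℕ × ℕ) (hz : z ∈ Tm cx μ) :
    ∃ x, 0 < μ x ∧ evar cx x = z := by
  unfold Tm at hz
  rw [Multiset.mem_map] at hz
  obtain ⟨x, hx, rfl⟩ := hz
  rw [Finsupp.mem_toMultiset, Finsupp.mem_support_iff] at hx
  exact ⟨x, Nat.pos_of_ne_zero hx, rfl⟩

theorem Tm_exists (cx : W → ℕ) (ν : Multiset (ℕ × ℕ)) (h : ∀ z ∈ ν, ∃ x, evar cx x = z) :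
    ∃ μ, Tm cx μ = ν := by
  induction ν using Multiset.induction_on with
  | empty => exact ⟨0, by simp [Tm]⟩
  | cons z s ih =>
    obtain ⟨μ, rfl⟩ := ih (fun y hy => h y (Multiset.mem_cons_of_mem hy))
    obtain ⟨x, rfl⟩ := h z (Multiset.mem_cons_self _ _)
    refine ⟨Finsupp.single x 1 + μ, ?_⟩
    rw [Tm_add, Tm_single, one_nsmul, Multiset.singleton_add]

theorem Tm_le (cx : W → ℕ) (μ ν : W →₀ ℕ) (h : Tm cx ν ≤ Tm cx μ) (x : W) : ν x ≤ μ x := by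
  have h1 := (Multiset.map_le_map_iff (evar_inj cx)).1 h
  have h2 := Multiset.le_iff_count.1 h1 x
  simpa [Finsupp.count_toMultiset] using h2

def rkv (cx : W → ℕ) (x : W) : ℕ := if cx x = 0 then pos cx x else pos cx x + Fintype.card W

theorem rkv_lt {cx : W → ℕ} {x y : W} (h : Low (evar cx y) (evar cx x)) (hne : y ≠ x) :
    rkv cx y < rkv cx x ∧ (cx y = cx x ∨ cx y = 0) := by
  rcases h with ⟨h1, h2⟩ | ⟨h1, h2⟩
  · simp only [evar] at h1 h2
    refine ⟨?_, Or.inl h1⟩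
    have : pos cx y < pos cx x := lt_of_le_of_ne h2 (fun e => hne (pos_inj h1 e))
    unfold rkv
    rw [h1]
    split_ifs <;> omega
  · simp only [evar] at h1 h2
    refine ⟨?_, Or.inr h1⟩
    unfold rkv
    rw [if_pos h1, if_neg h2]
    have := pos_pos cx x
    have h3 : pos cx y ≤ Fintype.card W := Finset.card_le_univ _
    omega

theorem stable_P {cx : W → ℕ} {M : Finset (W →₀ ℕ)}
    (hst : ∀ μ ∈ M, ∀ x y, 0 < μ x → rkv cx y < rkv cx x → (cx y = cx x ∨ cx y = 0) →
        cset x y μ (μ x - 1) (μ y + 1) ∈ M) (x y : ℕ × ℕ) (ν : Multiset (ℕ × ℕ))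
    (hP : ∃ μ ∈ M, Tm cx μ = x ::ₘ ν) (hy : ∃ y', evar cx y' = y) (hl : Low y x) :
    ∃ μ ∈ M, Tm cx μ = y ::ₘ ν := by
  obtain ⟨μ, hμ, hT⟩ := hP
  obtain ⟨x, hx, rfl⟩ := Tm_mem cx μ x (by rw [hT]; exact Multiset.mem_cons_self _ _)
  obtain ⟨y, rfl⟩ := hy
  by_cases hne : y = x
  · subst hne; exact ⟨μ, hμ, hT⟩
  obtain ⟨h1, h2⟩ := rkv_lt hl hne
  refine ⟨_, hst μ hμ x y hx h1 h2, ?_⟩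
  have e1 : μ = Finsupp.single x 1 + μ.update x (μ x - 1) := by
    ext z
    by_cases hz : z = x
    · subst hz; simp; omega
    · simp [hz]
  have e2 : cset x y μ (μ x - 1) (μ y + 1) = Finsupp.single y 1 + μ.update x (μ x - 1) := by
    ext z
    by_cases hz : z = x
    · subst hz; rw [cset_x (Ne.symm hne)]; simp [Ne.symm hne, hne]
    · by_cases hz' : z = y
      · subst hz'; rw [cset_y]; simp [hz]; omega
      · rw [cset_z hz hz']; simp [hz, hz']
  rw [e1, Tm_add, Tm_single, one_nsmul, Multiset.singleton_add, Multiset.cons_inj_right] at hT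
  rw [e2, Tm_add, Tm_single, one_nsmul, Multiset.singleton_add, hT]


theorem Phi_card (c : V → ℕ) (a : ℕ → ℕ) (m : ℕ) (B : Finset V) :
    Multiset.card (Phi c a m B) = (B.filter (fun v => vr c a m B v ≠ (0, 0))).card := by
  unfold Phi
  rw [Multiset.filter_map, Multiset.card_map]
  rfl

theorem Phi_swap (c : V → ℕ) (a : ℕ → ℕ) (m : ℕ) (B : Finset V) (u v : V) (hu : u ∉ B)
    (hv : v ∈ B) (f' : V → ℕ × ℕ) (h1 : f' v = vr c a m (insert u (B.erase v)) u)
    (h2 : ∀ w ∈ B.erase v, f' w = vr c a m (insert u (B.erase v)) w) :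
    (B.val.map f').filter (fun z => z ≠ (0, 0)) = Phi c a m (insert u (B.erase v)) := by
  unfold Phi
  congr 1
  rw [Finset.insert_val_of_notMem (fun h => hu (Finset.mem_of_mem_erase h)), Multiset.map_cons]
  conv_lhs => rw [← Finset.insert_erase hv, Finset.insert_val_of_notMem (Finset.notMem_erase v B),
    Multiset.map_cons, h1]
  congr 1
  exact Multiset.map_congr rfl fun w hw => h2 w hw

theorem facets_main (c : V → ℕ) (cx : W → ℕ) (a n : ℕ → ℕ) (m d : ℕ)
    (hd2 : d ≤ ∑ i ∈ Finset.Icc 1 m, a i)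
    (hc : ∀ v, 1 ≤ c v ∧ c v ≤ m)
    (hsizeV : ∀ i ∈ Finset.Icc 1 m, (Finset.univ.filter (fun v : V => c v = i)).card = n i)
    (horderV : ∀ v w : V, c v < c w → w < v)
    (ha : ∀ i ∈ Finset.Icc 1 m, 0 < a i ∧ a i ≤ n i)
    (hcx : ∀ x : W, cx x ≤ m)
    (hX0 : (Finset.univ.filter (fun x : W => cx x = 0)).card = (∑ i ∈ Finset.Icc 1 m, a i) - d)
    (hXi : ∀ i ∈ Finset.Icc 1 m, (Finset.univ.filter (fun x : W => cx x = i)).card = n i - a i)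
    (h : ℕ → ℕ)
    (M : Finset (W →₀ ℕ)) (hMS : ∀ μ ∈ M, InS cx a m d μ) (hMdc : DivClosed M)
    (hFM : ∀ j, FVec M j = h j) :
    ∃ (F : Finset (Finset V)) (R : Finset V → Finset V),
      (∀ B ∈ F, Fac c a m Finset.univ d B) ∧ (∀ B ∈ F, R B ⊆ B) ∧
      (∀ B ∈ F, ∀ B' ∈ F, R B ⊆ B' → B ≠ B' → toColex B < toColex B') ∧
      (∀ B ∈ F, ∀ v ∈ R B, ∃ B' ∈ F, toColex B' < toColex B ∧ B.erase v ⊆ B') ∧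
      ∀ r, (F.filter (fun B => (R B).card = r)).card = h r := by
  classical
  obtain ⟨M', hS, hdc, hFV, hst⟩ := compress cx a m d (rkv cx) M hMS hMdc
  have hbcU : ∀ i ∈ Finset.Icc 1 m, bc c Finset.univ i = n i := hsizeV
  have ha' : ∀ i ∈ Finset.Icc 1 m, a i ≤ bc c Finset.univ i := fun i hi => by
    rw [hbcU i hi]; exact (ha i hi).2
  obtain ⟨N, hN⟩ : ∃ N, N = (∑ i ∈ Finset.Icc 1 m, a i) - d := ⟨_, rfl⟩
  obtain ⟨b1, b2, b3⟩ := bij_main hc horderV _ Finset.univ rfl (fun _ _ w _ _ => Finset.mem_univ w)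
    a d N (by omega) ha'
  have hOm : ∀ y : ℕ × ℕ, (1 ≤ y.2 ∧ ((y.1 = 0 ∧ y.2 ≤ N) ∨
      (y.1 ∈ Finset.Icc 1 m ∧ y.2 + a y.1 ≤ bc c Finset.univ y.1))) ↔ ∃ x, evar cx x = y := by
    rintro ⟨i, k⟩
    constructor
    · rintro ⟨h1, ⟨rfl, h2⟩ | ⟨h2, h3⟩⟩
      · obtain ⟨x, hx, hp⟩ := pos_surj cx 0 k h1 (by rw [hX0, ← hN]; exact h2)
        exact ⟨x, by simp [evar, hx, hp]⟩
      · simp only at h1 h2 h3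
        rw [hbcU i h2] at h3
        obtain ⟨x, hx, hp⟩ := pos_surj cx i k h1 (by rw [hXi i h2]; omega)
        exact ⟨x, by simp [evar, hx, hp]⟩
    · rintro ⟨x, hx⟩
      simp only [evar, Prod.mk.injEq] at hx
      obtain ⟨rfl, rfl⟩ := hx
      refine ⟨pos_pos cx x, ?_⟩
      have h1 := pos_le cx x
      by_cases h0 : cx x = 0
      · left
        rw [h0, hX0, ← hN] at h1
        exact ⟨h0, h1⟩
      · right
        have hi : cx x ∈ Finset.Icc 1 m := by
          rw [Finset.mem_Icc]; exact ⟨Nat.pos_of_ne_zero h0, hcx x⟩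
        have := (ha _ hi).2
        rw [hXi _ hi] at h1
        simp only
        refine ⟨hi, ?_⟩
        rw [hbcU _ hi]
        omega
  have hTS : ∀ μ ∈ M', Smon c a m Finset.univ d N (Tm cx μ) := by
    intro μ hμ
    obtain ⟨s1, s2⟩ := hS μ hμ
    refine ⟨by rw [Tm_card]; exact s1, ?_, ?_⟩
    · intro i hi
      rw [Finset.mem_Icc] at hi
      rw [Tm_countP]
      exact s2 i hi.1 hi.2
    · intro z hz
      obtain ⟨x, -, hx⟩ := Tm_mem cx μ z hz
      exact (hOm z).2 ⟨x, hx⟩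
  have hdiv : ∀ μ ν : Multiset (ℕ × ℕ), (∃ μ' ∈ M', Tm cx μ' = μ) → ν ≤ μ →
      ∃ μ' ∈ M', Tm cx μ' = ν := by
    rintro _ ν ⟨μ, hμ, rfl⟩ hle
    obtain ⟨ν', rfl⟩ := Tm_exists cx ν (fun z hz => by
      obtain ⟨x, -, hx⟩ := Tm_mem cx μ z (Multiset.mem_of_le hle hz)
      exact ⟨x, hx⟩)
    exact ⟨ν', hdc μ hμ ν' (Tm_le cx μ ν' hle), rfl⟩
  refine ⟨Finset.univ.filter (fun B => Fac c a m Finset.univ d B ∧ ∃ μ' ∈ M', Tm cx μ' = Phi c a m B),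
    fun B => B.filter (fun v => vr c a m B v ≠ (0, 0)), ?_, ?_, ?_, ?_, ?_⟩
  · intro B hB
    exact (Finset.mem_filter.1 hB).2.1
  · intro B _
    exact Finset.filter_subset _ _
  · intro B hB B' hB' hR hne
    exact colex_lt_of_restr hc horderV (Finset.mem_filter.1 hB).2.1 (Finset.mem_filter.1 hB').2.1
      hR hne
  · intro B hB v hv
    rw [Finset.mem_filter] at hv
    obtain ⟨-, hBF, hBP⟩ := Finset.mem_filter.1 hB
    obtain ⟨u, huB, huv, hF', hl1, hl2⟩ := swap_exists hc horderV ha' hBF hv.1 hv.2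
    refine ⟨insert u (B.erase v), ?_, swap_colex B u v huB hv.1 huv, Finset.subset_insert _ _⟩
    rw [Finset.mem_filter]
    refine ⟨Finset.mem_univ _, hF', ?_⟩
    have hSm := (b1 _ hF').2.2
    set f' : V → ℕ × ℕ := fun w => if w = v then vr c a m (insert u (B.erase v)) u
      else vr c a m (insert u (B.erase v)) w with hf'
    have hfv : f' v = vr c a m (insert u (B.erase v)) u := by simp [hf']
    have hfw : ∀ w ∈ B.erase v, f' w = vr c a m (insert u (B.erase v)) w := by
      intro w hw
      have := Finset.ne_of_mem_erase hw
      simp [hf', this]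
    have hPe := Phi_swap c a m B u v huB hv.1 f' hfv hfw
    have hfin := lower_all (fun μ => ∃ μ' ∈ M', Tm cx μ' = μ) (fun y => ∃ x, evar cx x = y)
      (fun y hy => ((hOm y).2 hy).1) hdiv (fun x y ν hP hy hxy => stable_P hst x y ν hP hy hxy)
      (vr c a m B) f' B.val ?_ ?_ 0 ?_
    · rw [add_zero, hPe] at hfin
      exact hfin
    · intro w hw h0
      rw [← hOm]
      apply hSm
      rw [← hPe, Multiset.mem_filter]
      exact ⟨Multiset.mem_map_of_mem _ hw, h0⟩
    · intro w hw
      by_cases e : w = v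
      · subst e; rw [hfv]; exact hl1
      · have : w ∈ B.erase v := Finset.mem_erase.2 ⟨e, hw⟩
        rw [hfw w this]; exact hl2 w this
    · rw [add_zero]; exact hBP
  · intro r
    rw [← hFM, ← hFV, FVec]
    symm
    have hex : ∀ μ ∈ M', ∃ B, Fac c a m Finset.univ d B ∧ Phi c a m B = Tm cx μ :=
      fun μ hμ => b3 _ (hTS μ hμ)
    choose! g hg1 hg2 using hex
    apply Finset.card_bij (fun μ _ => g μ)
    · intro μ hμ
      rw [Finset.mem_filter] at hμ
      simp only [Finset.mem_filter, Finset.mem_univ, true_and]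
      refine ⟨⟨hg1 μ hμ.1, μ, hμ.1, (hg2 μ hμ.1).symm⟩, ?_⟩
      rw [← Phi_card, hg2 μ hμ.1, Tm_card]
      exact hμ.2
    · intro μ hμ μ' hμ' e
      rw [Finset.mem_filter] at hμ hμ'
      apply Tm_inj cx
      rw [← hg2 μ hμ.1, ← hg2 μ' hμ'.1, e]
    · intro B hB
      simp only [Finset.mem_filter, Finset.mem_univ, true_and] at hB
      obtain ⟨⟨hBF, μ, hμ, hT⟩, hr⟩ := hB
      refine ⟨μ, ?_, ?_⟩
      · rw [Finset.mem_filter]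
        refine ⟨hμ, ?_⟩
        rw [← Tm_card cx, hT, Phi_card]
        exact hr
      · exact b2 _ _ (hg1 μ hμ) hBF ((hg2 μ hμ).trans hT)


open Classical Polynomial in
/-- Implication `3 → 2` of the main theorem: if `h` is the F-vector of a multicomplex
`M ⊆ S_d(X,(∞,a))` (with `|X₀| = (∑ a_i) - d`, `|X_i| = n_i - a_i`), then `h` is the
h-vector of a `(d-1)`-dimensional shellable subcomplex of `Λ_d(n,a)`. -/
theorem stmt17 (c : V → ℕ) (cx : W → ℕ) (a n : ℕ → ℕ) (m d : ℕ)
    (hm : 1 ≤ m) (hd1 : 1 ≤ d) (hd2 : d ≤ ∑ i ∈ Finset.Icc 1 m, a i)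
    (hc : ∀ v, 1 ≤ c v ∧ c v ≤ m)
    (hsizeV : ∀ i ∈ Finset.Icc 1 m, (Finset.univ.filter (fun v : V => c v = i)).card = n i)
    (horderV : ∀ v w : V, c v < c w → w < v)
    (ha : ∀ i ∈ Finset.Icc 1 m, 0 < a i ∧ a i ≤ n i)
    (hcx : ∀ x : W, cx x ≤ m) (horderW : ∀ x y : W, cx x < cx y → y < x)
    (hX0 : (Finset.univ.filter (fun x : W => cx x = 0)).card = (∑ i ∈ Finset.Icc 1 m, a i) - d)
    (hXi : ∀ i ∈ Finset.Icc 1 m, (Finset.univ.filter (fun x : W => cx x = i)).card = n i - a i)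
    (h : ℕ → ℕ)
    (M : Finset (W →₀ ℕ)) (hMS : ∀ μ ∈ M, InS cx a m d μ) (hMdc : DivClosed M)
    (hFM : ∀ j, FVec M j = h j) :
    ∃ Δ : Finset (Finset V),
      -- a simplicial complex…
      (∀ σ ∈ Δ, ∀ ρ ⊆ σ, ρ ∈ Δ) ∧
      -- …which is a subcomplex of `Λ_d`…
      (∀ σ ∈ Δ, σ.card ≤ d ∧ ∀ i ∈ Finset.Icc 1 m, (σ.filter (fun v => c v = i)).card ≤ a i) ∧
      -- …pure of dimension `d-1`…
      (∀ σ ∈ Δ, ∃ τ ∈ Δ, τ.card = d ∧ σ ⊆ τ) ∧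
      (M.Nonempty → ∃ τ ∈ Δ, τ.card = d) ∧
      -- …shellable…
      (∃ l : List (Finset V), l.Nodup ∧ (∀ τ, τ ∈ l ↔ τ ∈ Δ ∧ τ.card = d) ∧
        ∀ (k : ℕ) (hk : k < l.length), ∀ γ ⊆ l.get ⟨k, hk⟩,
          ((l.get ⟨k, hk⟩).filter
              (fun v => ∃ τ' ∈ l.take k, (l.get ⟨k, hk⟩).erase v ⊆ τ') ⊆ γ
            ↔ ∀ τ' ∈ l.take k, ¬ γ ⊆ τ')) ∧
      -- …with h-vector `h`
      (∑ i ∈ Finset.range (d + 1),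
          (C (((Δ.filter (fun σ => σ.card = i)).card : ℤ))) * (X - 1) ^ (d - i)
        = ∑ i ∈ Finset.range (d + 1), (C ((h i : ℤ))) * X ^ (d - i)) := by
  obtain ⟨F, R, hFac, hR, h1, h2, h3⟩ := facets_main c cx a n m d hd2 hc hsizeV horderV ha hcx hX0
    hXi h M hMS hMdc hFM
  obtain ⟨⟨l, hl1, hl2, hl3⟩, hpoly⟩ := shell_abs F d (fun B hB => (hFac B hB).2.1) R hR toColex
    h1 h2 h h3
  have hmem : ∀ σ, σ ∈ F.biUnion Finset.powerset ↔ ∃ B ∈ F, σ ⊆ B := by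
    intro σ
    simp only [Finset.mem_biUnion, Finset.mem_powerset]
  have hfac : ∀ τ, τ ∈ F ↔ τ ∈ F.biUnion Finset.powerset ∧ τ.card = d := by
    intro τ
    rw [hmem]
    constructor
    · intro hτ
      exact ⟨⟨τ, hτ, Finset.Subset.refl _⟩, (hFac τ hτ).2.1⟩
    · rintro ⟨⟨B, hB, hs⟩, hcard⟩
      rw [Finset.eq_of_subset_of_card_le hs (by rw [hcard, (hFac B hB).2.1])]
      exact hB
  refine ⟨F.biUnion Finset.powerset, ?_, ?_, ?_, ?_, ⟨l, hl1, ?_, ?_⟩, ?_⟩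
  · intro σ hσ ρ hρ
    rw [hmem] at hσ ⊢
    obtain ⟨B, hB, hs⟩ := hσ
    exact ⟨B, hB, hρ.trans hs⟩
  · intro σ hσ
    rw [hmem] at hσ
    obtain ⟨B, hB, hs⟩ := hσ
    refine ⟨(Finset.card_le_card hs).trans (hFac B hB).2.1.le, fun i hi => ?_⟩
    exact (bc_mono c hs i).trans ((hFac B hB).2.2 i hi)
  · intro σ hσ
    rw [hmem] at hσ
    obtain ⟨B, hB, hs⟩ := hσ
    exact ⟨B, ((hfac B).1 hB).1, (hFac B hB).2.1, hs⟩
  · rintro ⟨μ, hμ⟩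
    have h0 : (0 : W →₀ ℕ) ∈ M := hMdc μ hμ 0 (fun x => Nat.zero_le _)
    have h4 : 0 < h 0 := by
      rw [← hFM 0]
      exact Finset.card_pos.2 ⟨0, Finset.mem_filter.2 ⟨h0, by simp [degM]⟩⟩
    rw [← h3 0, Finset.card_pos] at h4
    obtain ⟨B, hB⟩ := h4
    have hBF := (Finset.mem_filter.1 hB).1
    exact ⟨B, (hfac B).1 hBF⟩
  · intro τ
    rw [hl2, hfac]
  · intro k hk γ hγ
    rw [← hl3 k hk γ hγ, Finset.subset_iff]
    constructor
    · intro H v hv hex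
      refine H (Finset.mem_filter.2 ⟨hv, ?_⟩)
      convert hex
    · intro H v hv
      obtain ⟨hv1, hv2⟩ := Finset.mem_filter.1 hv
      refine H v hv1 ?_
      convert hv2
  · convert hpoly
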